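/- arXiv:2303.15809 — 3 statements merged into one kernel-verified Lean document; each statement's English description precedes it below -/
import Mathlib

section
/- Under the noise assumption, for any regularization parameter λ ≥ 0, the conditional expected generalization error of the kernel ridge regression estimator is lower bounded by the variance term: E(‖f̂_λ − f*_ρ‖²_{L²(μ)} ∣ X) ≥ V(λ) := (σ²/n²) ∫_𝒳 𝕂(x,X)(K+λ)^{−2}𝕂(X,x) dμ(x). -/
open MeasureTheory ProbabilityTheory Matrix

lemma krr_pointwise {n : ℕ} {Ω : Type*} [MeasurableSpace Ω] (P : Measure Ω)
    [IsProbabilityMeasure P]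
    (eps : Fin n → Ω → ℝ) (hL : ∀ i, MemLp (eps i) 2 P)
    (heps_indep : iIndepFun eps P)
    (heps_mean : ∀ i, ∫ ω, eps i ω ∂P = 0)
    (σ2 : ℝ) (heps_var : ∀ i, σ2 ≤ ∫ ω, eps i ω ^ 2 ∂P)
    (a : Fin n → ℝ) (c : ℝ) :
    ENNReal.ofReal (σ2 * ∑ i, a i ^ 2) ≤
      ∫⁻ ω, ENNReal.ofReal ((c + ∑ i, a i * eps i ω) ^ 2) ∂P := by
  have hL' : ∀ i, MemLp (fun ω => a i * eps i ω) 2 P := fun i => (hL i).const_mul (a i)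
  have hS : MemLp (∑ i, fun ω => a i * eps i ω) 2 P := memLp_finsetSum' _ fun i _ => hL' i
  have hSe : (∑ i, fun ω => a i * eps i ω) = fun ω => ∑ i, a i * eps i ω := by
    ext ω; simp
  have hZ : MemLp (fun ω => c + ∑ i, a i * eps i ω) 2 P := by
    rw [hSe] at hS
    exact (memLp_const c).add hS
  rw [← ofReal_integral_eq_lintegral_ofReal hZ.integrable_sq
    (Filter.Eventually.of_forall fun ω => sq_nonneg _)]
  apply ENNReal.ofReal_le_ofReal
  have h1 : variance (fun ω => c + ∑ i, a i * eps i ω) P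
      ≤ ∫ ω, (c + ∑ i, a i * eps i ω) ^ 2 ∂P := by
    have := variance_le_expectation_sq (μ := P) hZ.aestronglyMeasurable
    simpa using this
  refine le_trans ?_ h1
  rw [variance_const_add (by rw [← hSe]; exact hS.aestronglyMeasurable), ← hSe,
    IndepFun.variance_sum (fun i _ => hL' i), Finset.mul_sum]
  · apply Finset.sum_le_sum
    intro i _
    rw [variance_const_mul, variance_of_integral_eq_zero (hL i).aemeasurable (heps_mean i)]
    nlinarith [heps_var i, sq_nonneg (a i)]
  · intro i _ j _ hij
    exact (heps_indep.indepFun hij).comp (measurable_const_mul (a i)) (measurable_const_mul (a j))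

/-- Under the noise assumption, for any `λ ≥ 0`, the conditional (on `X`)
expected generalization error of kernel ridge regression is lower bounded by the variance
term: `E(‖f̂_λ - f*_ρ‖²_{L²(μ)} | X) ≥ V(λ) = (σ²/n²) ∫ 𝕂(x,X)(K+λ)⁻² 𝕂(X,x) dμ(x)`.

Conditioning on `X` is modelled by fixing the sample inputs `x₁,…,xₙ` and letting
`yᵢ = f*_ρ(xᵢ) + εᵢ` with conditionally independent, mean-zero noises `εᵢ` of variance
at least `σ²`; `f̂_λ(t) = (1/n) 𝕂(t,X)(K+λ)⁻¹ Y` with `K = 𝕂(X,X)/n`. The expectation of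
the squared `L²(μ)` error is written as a Lebesgue integral of its nonnegative integrand. -/
theorem kernel_interp_stmt1 {𝓧 : Type*} [MeasurableSpace 𝓧]
    (μ : Measure 𝓧) [IsProbabilityMeasure μ]
    (k : 𝓧 → 𝓧 → ℝ) (hk_meas : Measurable (Function.uncurry k))
    (hk_symm : ∀ x y, k x y = k y x)
    (fstar : 𝓧 → ℝ) (hfstar : Measurable fstar)
    (n : ℕ) (hn : 0 < n) (x : Fin n → 𝓧)
    (hPD : (Matrix.of fun i j => k (x i) (x j)).PosDef)
    {Ω : Type*} [MeasurableSpace Ω] (P : Measure Ω) [IsProbabilityMeasure P]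
    (eps : Fin n → Ω → ℝ) (heps_meas : ∀ i, Measurable (eps i))
    (heps_indep : iIndepFun eps P)
    (heps_int : ∀ i, Integrable (eps i) P)
    (heps_mean : ∀ i, ∫ ω, eps i ω ∂P = 0)
    (σ2 : ℝ) (hσ2 : 0 < σ2)
    (heps_var : ∀ i, σ2 ≤ ∫ ω, eps i ω ^ 2 ∂P)
    (y : Fin n → Ω → ℝ) (hy : ∀ i ω, y i ω = fstar (x i) + eps i ω)
    (lam : ℝ) (hlam : 0 ≤ lam) :
    ENNReal.ofReal
        (σ2 / (n : ℝ) ^ 2 * ∫ t,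
          (fun i => k t (x i)) ⬝ᵥ
            ((((Matrix.of fun i j => k (x i) (x j) / n)
                + lam • (1 : Matrix (Fin n) (Fin n) ℝ))⁻¹ ^ 2) *ᵥ fun i => k t (x i)) ∂μ)
      ≤ ∫⁻ ω, ∫⁻ t, ENNReal.ofReal
          (((n : ℝ)⁻¹ *
              ((fun i => k t (x i)) ⬝ᵥ
                (((Matrix.of fun i j => k (x i) (x j) / n)
                    + lam • (1 : Matrix (Fin n) (Fin n) ℝ))⁻¹ *ᵥ fun i => y i ω))
            - fstar t) ^ 2) ∂μ ∂P := by
  have hL : ∀ i, MemLp (eps i) 2 P := by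
    intro i
    rw [memLp_two_iff_integrable_sq (heps_meas i).aestronglyMeasurable]
    by_contra h
    have := heps_var i
    rw [integral_undef h] at this
    linarith
  have hkm : ∀ i, Measurable fun t => k t (x i) := fun i =>
    hk_meas.comp (measurable_id.prodMk measurable_const)
  set A : Matrix (Fin n) (Fin n) ℝ := ((Matrix.of fun i j => k (x i) (x j) / n)
                + lam • (1 : Matrix (Fin n) (Fin n) ℝ))⁻¹ with hA
  have hAt : Aᵀ = A := by
    rw [hA, Matrix.transpose_nonsing_inv]
    congr 1
    ext i j
    simp [Matrix.one_apply, hk_symm (x j) (x i), eq_comm]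
  set a : 𝓧 → Fin n → ℝ := fun t i => (n : ℝ)⁻¹ * ((fun i => k t (x i)) ᵥ* A) i with ha
  set c : 𝓧 → ℝ := fun t => ∑ i, a t i * fstar (x i) - fstar t with hc
  have e1 : ∀ t, (fun i => k t (x i)) ⬝ᵥ ((A ^ 2) *ᵥ fun i => k t (x i))
      = (n : ℝ) ^ 2 * ∑ i, a t i ^ 2 := by
    intro t
    have hn' : (n : ℝ) ≠ 0 := by positivity
    have hv : A *ᵥ (fun i => k t (x i)) = (fun i => k t (x i)) ᵥ* A := by
      conv_rhs => rw [← hAt]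
      rw [Matrix.vecMul_transpose]
    rw [pow_two, ← Matrix.mulVec_mulVec, Matrix.dotProduct_mulVec, hv]
    simp only [dotProduct, ha, Finset.mul_sum]
    refine Finset.sum_congr rfl fun i _ => ?_
    field_simp
  have e2 : ∀ t ω, (n : ℝ)⁻¹ * ((fun i => k t (x i)) ⬝ᵥ (A *ᵥ fun i => y i ω)) - fstar t
      = c t + ∑ i, a t i * eps i ω := by
    intro t ω
    rw [Matrix.dotProduct_mulVec]
    simp only [dotProduct, hc, ha, hy, Finset.mul_sum, mul_add, Finset.sum_add_distrib, mul_assoc]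
    ring
  have ham : ∀ i, Measurable fun t => a t i := by
    intro i
    simp only [ha, Matrix.vecMul, dotProduct]
    exact (Finset.measurable_sum _ fun j _ => (hkm j).mul_const _).const_mul _
  have hcm : Measurable c :=
    (Finset.measurable_sum _ fun i _ => (ham i).mul_const _).sub hfstar
  simp only [e1, e2]
  rw [lintegral_lintegral_swap]
  swap
  · apply Measurable.aemeasurable
    refine ENNReal.measurable_ofReal.comp (Measurable.pow_const ?_ 2)
    refine (hcm.comp measurable_snd).add (Finset.measurable_sum _ fun i _ => ?_)
    exact ((ham i).comp measurable_snd).mul ((heps_meas i).comp measurable_fst)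
  have e3 : σ2 / (n : ℝ) ^ 2 * ∫ t, (n : ℝ) ^ 2 * ∑ i, a t i ^ 2 ∂μ
      = ∫ t, σ2 * ∑ i, a t i ^ 2 ∂μ := by
    have hn' : (n : ℝ) ≠ 0 := by positivity
    rw [integral_const_mul, integral_const_mul]
    field_simp
  rw [e3]
  calc ENNReal.ofReal (∫ t, σ2 * ∑ i, a t i ^ 2 ∂μ)
      ≤ ∫⁻ t, ENNReal.ofReal (σ2 * ∑ i, a t i ^ 2) ∂μ := by
        by_cases h : Integrable (fun t => σ2 * ∑ i, a t i ^ 2) μ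
        · exact (ofReal_integral_eq_lintegral_ofReal h
            (Filter.Eventually.of_forall fun t => by positivity)).le
        · rw [integral_undef h]; simp
    _ ≤ _ := lintegral_mono fun t =>
        krr_pointwise P eps hL heps_indep heps_mean σ2 heps_var (a t) (c t)
end

section
/- Under the eigenvalue decay, embedding index, Hölder continuity, and noise assumptions, suppose λ = λ(n) → 0 satisfies λ = Ω(n^{−β+p}) for some p > 0. Then for any δ ∈ (0,1), when n is sufficiently large (depending on δ and p), with probability at least 1−δ over the sample: c σ² λ^{−1/β}/n ≤ V(λ) ≤ C σ² λ^{−1/β}/n, where c, C > 0 are absolute constants not depending on δ, n, λ. -/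
open MeasureTheory ProbabilityTheory Filter Matrix

/-- The variance term `V(λ) = (σ²/n²) ∫ 𝕂(x,X)(K+λ)⁻² 𝕂(X,x) dμ(x)` of kernel ridge
regression with sample inputs `x₁,…,xₙ`, where `K = 𝕂(X,X)/n`. -/
noncomputable def varianceTerm10 {𝓧 : Type*} [MeasurableSpace 𝓧] (μ : Measure 𝓧)
    (k : 𝓧 → 𝓧 → ℝ) (σ2 : ℝ) (n : ℕ) (x : Fin n → 𝓧) (lam : ℝ) : ℝ :=
  σ2 / (n : ℝ) ^ 2 * ∫ t,
    (fun i => k t (x i)) ⬝ᵥ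
      ((((Matrix.of fun i j => k (x i) (x j) / n) + lam • (1 : Matrix (Fin n) (Fin n) ℝ))⁻¹ ^ 2)
        *ᵥ fun i => k t (x i)) ∂μ


section GT
variable {ι : Type*} [Fintype ι] [DecidableEq ι]

lemma aux_mul_pow_comm {R : Type*} [Monoid R] (X Y : R) (q : ℕ) :
    (X * Y) ^ q * X = X * (Y * X) ^ q := by
  induction q with
  | zero => simp
  | succ q ih => rw [pow_succ', mul_assoc, ih, pow_succ' (Y * X)]; simp only [mul_assoc]

lemma aux_trace_pow_comm (X Y : Matrix ι ι ℝ) (q : ℕ) :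
    trace ((X * Y) ^ q) = trace ((Y * X) ^ q) := by
  cases q with
  | zero => simp
  | succ q =>
    rw [pow_succ, ← mul_assoc, aux_mul_pow_comm, mul_assoc, Matrix.trace_mul_comm, mul_assoc, ← pow_succ]

lemma aux_pair_list {R : Type*} [Monoid R] (q : ℕ) : ∀ l : List R, l.length = 2 * q →
    ∃ l' : List R, l'.length = q ∧ l'.prod = l.prod ∧ ∀ N ∈ l', ∃ P ∈ l, ∃ Q ∈ l, N = P * Q := by
  induction q with
  | zero => intro l hl; refine ⟨[], by simp, ?_, by simp⟩
            have : l = [] := List.length_eq_zero_iff.mp (by simpa using hl)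
            simp [this]
  | succ q ih =>
    intro l hl
    match l, hl with
    | [], h => simp at h
    | [a], h => simp at h; omega
    | a :: b :: t, h =>
      obtain ⟨l', h1, h2, h3⟩ := ih t (by simp at h; omega)
      refine ⟨(a * b) :: l', by simp [h1], by simp [h2, mul_assoc], ?_⟩
      intro N hN
      rcases List.mem_cons.mp hN with rfl | hN
      · exact ⟨a, by simp, b, by simp, rfl⟩
      · obtain ⟨P, hP, Q, hQ, e⟩ := h3 N hN
        exact ⟨P, by simp [hP], Q, by simp [hQ], e⟩

lemma aux_alt_list {R : Type*} [Monoid R] (X Y : R) (q : ℕ) :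
    ∃ l : List R, l.length = 2 * q ∧ l.prod = (X * Y) ^ q ∧ ∀ N ∈ l, N = X ∨ N = Y := by
  induction q with
  | zero => exact ⟨[], by simp⟩
  | succ q ih =>
    obtain ⟨l, h1, h2, h3⟩ := ih
    refine ⟨X :: Y :: l, by simp [h1]; omega, by simp [h2, pow_succ', mul_assoc], ?_⟩
    intro N hN
    simp only [List.mem_cons] at hN
    rcases hN with h | h | h
    · exact Or.inl h
    · exact Or.inr h
    · exact h3 N h

lemma aux_trace_mul_le (M N : Matrix ι ι ℝ) (a : ℝ) (hM : trace (M * Mᵀ) ≤ a)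
    (hN : trace (N * Nᵀ) ≤ a) : |trace (M * N)| ≤ a := by
  have e1 : trace (M * Mᵀ) = ∑ i, ∑ j, M i j ^ 2 := by
    simp [trace, Matrix.mul_apply, sq]
  have e2 : trace (N * Nᵀ) = ∑ i, ∑ j, N j i ^ 2 := by
    rw [Finset.sum_comm]; simp [trace, Matrix.mul_apply, sq]
  have e3 : trace (M * N) = ∑ i, ∑ j, M i j * N j i := by
    simp [trace, Matrix.mul_apply]
  have h : 2 * |trace (M * N)| ≤ trace (M * Mᵀ) + trace (N * Nᵀ) := by
    rw [e1, e2, e3, ← Finset.sum_add_distrib]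
    calc 2 * |∑ i, ∑ j, M i j * N j i| ≤ 2 * ∑ i, ∑ j, |M i j * N j i| := by
          gcongr
          refine (Finset.abs_sum_le_sum_abs _ _).trans (Finset.sum_le_sum fun i _ => Finset.abs_sum_le_sum_abs _ _)
      _ ≤ _ := by
          rw [Finset.mul_sum]
          refine Finset.sum_le_sum fun i _ => ?_
          rw [Finset.mul_sum, ← Finset.sum_add_distrib]
          refine Finset.sum_le_sum fun j _ => ?_
          rw [abs_mul]
          nlinarith [sq_nonneg (|M i j| - |N j i|), sq_abs (M i j), sq_abs (N j i)]
  linarith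

lemma aux_trace_prod_le (k : ℕ) : ∀ (a : ℝ) (l : List (Matrix ι ι ℝ)), l.length = 2 ^ (k + 1) →
    (∀ M ∈ l, trace ((M * Mᵀ) ^ (2 ^ k)) ≤ a) → |trace l.prod| ≤ a := by
  induction k with
  | zero =>
    intro a l hl h
    match l, hl with
    | [M, N], _ =>
      simp at h
      simpa using aux_trace_mul_le M N a h.1 h.2
  | succ k ih =>
    intro a l hl h
    obtain ⟨l', h1, h2, h3⟩ := aux_pair_list (2 ^ (k + 1)) l (by rw [hl]; ring)
    rw [← h2]
    refine ih a l' h1 ?_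
    intro N hN
    obtain ⟨P, hP, Q, hQ, rfl⟩ := h3 N hN
    have e : P * Q * (P * Q)ᵀ = P * (Q * Qᵀ * Pᵀ) := by
      rw [Matrix.transpose_mul]; simp only [mul_assoc]
    rw [e, aux_trace_pow_comm, mul_assoc (Q * Qᵀ)]
    obtain ⟨l2, g1, g2, g3⟩ := aux_alt_list (Q * Qᵀ) (Pᵀ * P) (2 ^ k)
    rw [← g2]
    refine (le_abs_self _).trans (ih a l2 (by rw [g1]; ring) ?_)
    intro M hM
    rcases g3 M hM with rfl | rfl
    · have := h Q hQ
      rw [Matrix.transpose_mul, Matrix.transpose_transpose, ← pow_two, ← pow_mul, ← pow_succ']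
      exact this
    · have := h P hP
      rw [Matrix.transpose_mul, Matrix.transpose_transpose, ← pow_two, ← pow_mul, ← pow_succ',
        aux_trace_pow_comm]
      exact this

lemma aux_trace_two_pow (k : ℕ) : ∀ (X Y : Matrix ι ι ℝ), Xᵀ = X → Yᵀ = Y →
    trace ((X * Y) ^ (2 ^ k)) ≤ trace (X ^ (2 ^ k) * Y ^ (2 ^ k)) := by
  induction k with
  | zero => intro X Y _ _; simp
  | succ k ih =>
    intro X Y hX hY
    have h1 : trace ((X * Y) ^ (2 ^ (k + 1))) ≤ trace ((X ^ 2 * Y ^ 2) ^ (2 ^ k)) := by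
      have := aux_trace_prod_le k (trace ((X ^ 2 * Y ^ 2) ^ (2 ^ k)))
        (List.replicate (2 ^ (k + 1)) (X * Y)) (by simp) ?_
      · rw [List.prod_replicate] at this
        exact (le_abs_self _).trans this
      · intro M hM
        rw [List.eq_of_mem_replicate hM, Matrix.transpose_mul, hX, hY]
        apply le_of_eq
        rw [mul_assoc X, aux_trace_pow_comm, aux_trace_pow_comm (X ^ 2)]
        simp only [pow_two, mul_assoc]
    refine h1.trans ((ih (X ^ 2) (Y ^ 2) (by simp [Matrix.transpose_pow, hX])
      (by simp [Matrix.transpose_pow, hY])).trans (le_of_eq ?_))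
    rw [← pow_mul, ← pow_mul, ← pow_succ']

lemma aux_pow_sub_pow {𝔸 : Type*} [NormedRing 𝔸] [NormOneClass 𝔸] (X Y : 𝔸) (C : ℝ) (hC : 1 ≤ C) (hX : ‖X‖ ≤ C)
    (hY : ‖Y‖ ≤ C) (N : ℕ) : ‖X ^ N - Y ^ N‖ ≤ N * ‖X - Y‖ * C ^ N := by
  induction N with
  | zero => simp
  | succ N ih =>
    have e : X ^ (N + 1) - Y ^ (N + 1) = X ^ N * (X - Y) + (X ^ N - Y ^ N) * Y := by
      rw [pow_succ, pow_succ]; noncomm_ring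
    rw [e]
    have hC0 : 0 ≤ C := by linarith
    calc _ ≤ ‖X ^ N‖ * ‖X - Y‖ + ‖X ^ N - Y ^ N‖ * ‖Y‖ :=
          (norm_add_le _ _).trans (add_le_add (norm_mul_le _ _) (norm_mul_le _ _))
      _ ≤ C ^ N * ‖X - Y‖ + (N * ‖X - Y‖ * C ^ N) * C := by
          gcongr
          exact (norm_pow_le _ _).trans (pow_le_pow_left₀ (norm_nonneg _) hX _)
      _ ≤ _ := by
          have : C ^ N * ‖X - Y‖ ≤ ‖X - Y‖ * C ^ (N + 1) := by
            rw [mul_comm]; gcongr <;> simp [hC]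
          push_cast
          rw [pow_succ] at *
          nlinarith

end GT


lemma aux_norm_exp_le {𝔸 : Type*} [NormedRing 𝔸] [NormedAlgebra ℝ 𝔸] [CompleteSpace 𝔸]
    [NormOneClass 𝔸] (x : 𝔸) : ‖NormedSpace.exp x‖ ≤ Real.exp ‖x‖ := by
  rw [NormedSpace.exp_eq_tsum ℝ, Real.exp_eq_exp_ℝ, NormedSpace.exp_eq_tsum ℝ]
  refine tsum_of_norm_bounded (f := fun n : ℕ => ((n.factorial : ℝ))⁻¹ • x ^ n) (NormedSpace.expSeries_summable' (𝕂 := ℝ) ‖x‖).hasSum ?_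
  intro n
  rw [norm_smul, smul_eq_mul]
  simp only [norm_inv, Real.norm_natCast]
  gcongr
  exact norm_pow_le _ _

lemma aux_lie_trotter {𝔸 : Type*} [NormedRing 𝔸] [NormedAlgebra ℝ 𝔸] [CompleteSpace 𝔸]
    [NormOneClass 𝔸] (A B : 𝔸) :
    Tendsto (fun N : ℕ => (NormedSpace.exp (((N : ℝ)⁻¹) • A) * NormedSpace.exp (((N : ℝ)⁻¹) • B)) ^ N)
      atTop (nhds (NormedSpace.exp (A + B))) := by
  set f : ℝ → 𝔸 := fun t => NormedSpace.exp (t • A) * NormedSpace.exp (t • B) -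
    NormedSpace.exp (t • (A + B)) with hf
  have hd : HasDerivAt f 0 0 := by
    have h1 := (hasDerivAt_exp_smul_const (𝕂 := ℝ) A (0 : ℝ)).mul (hasDerivAt_exp_smul_const (𝕂 := ℝ) B (0 : ℝ))
    have h2 := h1.sub (hasDerivAt_exp_smul_const (𝕂 := ℝ) (A + B) (0 : ℝ))
    convert! h2 using 1
    simp
  have hf0 : f 0 = 0 := by simp [hf]
  have hlim : Tendsto (fun N : ℕ => (N : ℝ) * ‖f ((N : ℝ)⁻¹)‖) atTop (nhds 0) := by
    have h1 := hd.isLittleO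
    simp only [sub_zero, hf0, smul_zero] at h1
    have h2 : Tendsto (fun N : ℕ => ((N : ℝ))⁻¹) atTop (nhds 0) := tendsto_inv_atTop_nhds_zero_nat
    have h3 := (h1.comp_tendsto h2).norm_norm.tendsto_div_nhds_zero
    refine h3.congr (fun N => ?_)
    simp [Function.comp, div_eq_mul_inv, mul_comm]
  have key : ∀ N : ℕ, 1 ≤ N → ‖(NormedSpace.exp (((N : ℝ)⁻¹) • A) * NormedSpace.exp (((N : ℝ)⁻¹) • B)) ^ N
      - NormedSpace.exp (A + B)‖ ≤ ((N : ℝ) * ‖f ((N : ℝ)⁻¹)‖) * Real.exp (‖A‖ + ‖B‖) := by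
    intro N hN
    have hN0 : (0 : ℝ) < N := by exact_mod_cast hN
    letI : NormedAlgebra ℚ 𝔸 := NormedAlgebra.restrictScalars ℚ ℝ 𝔸
    have e : NormedSpace.exp (A + B) = (NormedSpace.exp (((N : ℝ)⁻¹) • (A + B))) ^ N := by
      rw [← NormedSpace.exp_nsmul, ← Nat.cast_smul_eq_nsmul ℝ, smul_smul, mul_inv_cancel₀ hN0.ne', one_smul]
    rw [e]
    set C := Real.exp ((N : ℝ)⁻¹ * (‖A‖ + ‖B‖)) with hC
    have hCN : C ^ N = Real.exp (‖A‖ + ‖B‖) := by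
      rw [hC, ← Real.exp_nat_mul]; congr 1; field_simp
    have hn : ∀ D : 𝔸, ‖(N : ℝ)⁻¹ • D‖ = (N : ℝ)⁻¹ * ‖D‖ := by
      intro D; rw [norm_smul]; simp
    have := aux_pow_sub_pow (NormedSpace.exp (((N : ℝ)⁻¹) • A) * NormedSpace.exp (((N : ℝ)⁻¹) • B))
      (NormedSpace.exp (((N : ℝ)⁻¹) • (A + B))) C
      (Real.one_le_exp (by positivity)) ?_ ?_ N
    · rw [hCN] at this; exact this
    · refine (norm_mul_le _ _).trans ?_
      rw [hC, mul_add, Real.exp_add, ← hn, ← hn]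
      gcongr <;> exact aux_norm_exp_le _
    · refine (aux_norm_exp_le _).trans ?_
      rw [hn, hC]
      gcongr
      exact norm_add_le _ _
  rw [tendsto_iff_norm_sub_tendsto_zero]
  refine squeeze_zero' (Eventually.of_forall fun _ => norm_nonneg _)
    ((eventually_ge_atTop 1).mono key) ?_
  simpa using hlim.mul_const (Real.exp (‖A‖ + ‖B‖))

lemma aux_symm_exp {ι : Type*} [Fintype ι] [DecidableEq ι] (A : Matrix ι ι ℝ)
    (hA : Aᵀ = A) : (NormedSpace.exp A)ᵀ = NormedSpace.exp A := by
  rw [← Matrix.exp_transpose, hA]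

lemma aux_exp_root {ι : Type*} [Fintype ι] [DecidableEq ι] (D : Matrix ι ι ℝ) (N : ℕ)
    (hN0 : (N : ℝ) ≠ 0) :
    NormedSpace.exp D = (NormedSpace.exp (((N : ℝ)⁻¹) • D)) ^ N := by
  rw [← Matrix.exp_nsmul, ← Nat.cast_smul_eq_nsmul ℝ, smul_smul, mul_inv_cancel₀ hN0, one_smul]

lemma aux_lie_trotter_matrix {ι : Type*} [Fintype ι] [DecidableEq ι] [Nonempty ι]
    (A B : Matrix ι ι ℝ) :
    Tendsto (fun N : ℕ => (NormedSpace.exp (((N : ℝ)⁻¹) • A) * NormedSpace.exp (((N : ℝ)⁻¹) • B)) ^ N)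
      atTop (nhds (NormedSpace.exp (A + B))) := by
  letI := Matrix.linftyOpNormedRing (n := ι) (α := ℝ)
  letI := Matrix.linftyOpNormedAlgebra (n := ι) (R := ℝ) (α := ℝ)
  have : NormOneClass (Matrix ι ι ℝ) := Matrix.linfty_opNormOneClass
  exact aux_lie_trotter A B

lemma aux_golden_thompson {ι : Type*} [Fintype ι] [DecidableEq ι] (A B : Matrix ι ι ℝ)
    (hA : Aᵀ = A) (hB : Bᵀ = B) :
    trace (NormedSpace.exp (A + B)) ≤ trace (NormedSpace.exp A * NormedSpace.exp B) := by
  rcases isEmpty_or_nonempty ι with h | h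
  · simp [trace]
  have h1 := aux_lie_trotter_matrix A B
  have h2 : Tendsto (fun k : ℕ => 2 ^ k) atTop (atTop : Filter ℕ) :=
    tendsto_pow_atTop_atTop_of_one_lt (by norm_num)
  have h3 := h1.comp h2
  have hc : Continuous (fun M : Matrix ι ι ℝ => trace M) := continuous_id.matrix_trace
  have h4 := (hc.tendsto _).comp h3
  refine le_of_tendsto h4 (Eventually.of_forall fun k => ?_)
  simp only [Function.comp]
  set N : ℕ := 2 ^ k with hN
  have hN0 : (N : ℝ) ≠ 0 := by simp [hN]
  rw [aux_exp_root A N hN0, aux_exp_root B N hN0]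
  refine aux_trace_two_pow k _ _ ?_ ?_
  · exact aux_symm_exp _ (by rw [Matrix.transpose_smul, hA])
  · exact aux_symm_exp _ (by rw [Matrix.transpose_smul, hB])

lemma aux_exp_continuous {ι : Type*} [Fintype ι] [DecidableEq ι] :
    Continuous (fun M : Matrix ι ι ℝ => NormedSpace.exp M) := by
  letI := Matrix.linftyOpNormedRing (n := ι) (α := ℝ)
  letI := Matrix.linftyOpNormedAlgebra (n := ι) (R := ℝ) (α := ℝ)
  letI := NormedAlgebra.restrictScalars ℚ ℝ (Matrix ι ι ℝ)
  exact NormedSpace.exp_continuous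


section Spec
variable {ι : Type*} [Fintype ι] [DecidableEq ι]

lemma aux_spectral (A : Matrix ι ι ℝ) (hA : Aᵀ = A) : ∃ (U : Matrix ι ι ℝ) (d : ι → ℝ),
    Uᵀ * U = 1 ∧ U * Uᵀ = 1 ∧ A = U * diagonal d * Uᵀ := by
  have h : A.IsHermitian := by rw [Matrix.IsHermitian, conjTranspose_eq_transpose_of_trivial, hA]
  refine ⟨h.eigenvectorUnitary, h.eigenvalues, ?_, ?_, ?_⟩
  · have := Unitary.coe_star_mul_self h.eigenvectorUnitary
    rwa [Matrix.star_eq_conjTranspose, conjTranspose_eq_transpose_of_trivial] at this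
  · have := Unitary.coe_mul_star_self h.eigenvectorUnitary
    rwa [Unitary.coe_star, Matrix.star_eq_conjTranspose, conjTranspose_eq_transpose_of_trivial] at this
  · have := h.spectral_theorem
    rw [Unitary.conjStarAlgAut_apply, Matrix.star_eq_conjTranspose,
      conjTranspose_eq_transpose_of_trivial] at this
    exact this

lemma aux_exp_spectral (U : Matrix ι ι ℝ) (d : ι → ℝ) (h1 : Uᵀ * U = 1) (h2 : U * Uᵀ = 1) (t : ℝ) :
    NormedSpace.exp (t • (U * diagonal d * Uᵀ)) = U * diagonal (fun i => Real.exp (t * d i)) * Uᵀ := by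
  have hU : IsUnit U := ⟨⟨U, Uᵀ, h2, h1⟩, rfl⟩
  have hi : U⁻¹ = Uᵀ := Matrix.inv_eq_right_inv h2
  have e : t • (U * diagonal d * Uᵀ) = U * diagonal (fun i => t * d i) * U⁻¹ := by
    have e1 : diagonal (fun i => t * d i) = t • diagonal d := by
      ext i j; by_cases hij : i = j <;> simp [diagonal_apply, hij]
    rw [hi, e1]; simp
  rw [e, Matrix.exp_conj U _ hU, Matrix.exp_diagonal, hi]
  congr 2
  have e2 : NormedSpace.exp (fun i => t * d i) = fun i => Real.exp (t * d i) := by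
    funext i
    rw [Pi.coe_exp, Real.exp_eq_exp_ℝ]
  rw [e2]

lemma aux_quad_spectral (U : Matrix ι ι ℝ) (d : ι → ℝ) (v : ι → ℝ) :
    v ⬝ᵥ ((U * diagonal d * Uᵀ) *ᵥ v) = ∑ i, d i * (Uᵀ *ᵥ v) i ^ 2 := by
  rw [← Matrix.mulVec_mulVec, ← Matrix.mulVec_mulVec, Matrix.dotProduct_mulVec,
    ← Matrix.mulVec_transpose]
  simp only [dotProduct, Matrix.mulVec_diagonal]
  exact Finset.sum_congr rfl fun i _ => by ring

lemma aux_norm_spectral (U : Matrix ι ι ℝ) (h2 : U * Uᵀ = 1) (v : ι → ℝ) :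
    v ⬝ᵥ v = ∑ i, (Uᵀ *ᵥ v) i ^ 2 := by
  have := aux_quad_spectral U (fun _ => 1) v
  simp only [Matrix.diagonal_one, mul_one, h2, Matrix.one_mulVec, one_mul] at this
  exact this

lemma aux_eig (U : Matrix ι ι ℝ) (d : ι → ℝ) (h1 : Uᵀ * U = 1) (i : ι) :
    (U *ᵥ Pi.single i 1) ⬝ᵥ ((U * diagonal d * Uᵀ) *ᵥ (U *ᵥ Pi.single i 1)) = d i ∧
    (U *ᵥ Pi.single i 1) ⬝ᵥ (U *ᵥ Pi.single i 1) = 1 := by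
  have e : Uᵀ *ᵥ (U *ᵥ Pi.single i (1 : ℝ)) = Pi.single i 1 := by
    rw [Matrix.mulVec_mulVec, h1, Matrix.one_mulVec]
  constructor
  · rw [aux_quad_spectral, e]
    rw [Finset.sum_eq_single i] <;> simp +contextual [Pi.single_apply]
  · rw [Matrix.dotProduct_mulVec, ← Matrix.mulVec_transpose, e]; simp

lemma aux_exp_upper (A : Matrix ι ι ℝ) (hA : Aᵀ = A) (R : ℝ) (hR : 0 < R)
    (h0 : ∀ v, 0 ≤ v ⬝ᵥ (A *ᵥ v)) (h1 : ∀ v, v ⬝ᵥ (A *ᵥ v) ≤ R * (v ⬝ᵥ v)) (v : ι → ℝ) :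
    v ⬝ᵥ (NormedSpace.exp ((-R⁻¹) • A) *ᵥ v) ≤ v ⬝ᵥ ((1 - (R⁻¹ / 2) • A) *ᵥ v) := by
  obtain ⟨U, d, hU1, hU2, e⟩ := aux_spectral A hA
  have hd : ∀ i, 0 ≤ d i ∧ d i ≤ R := by
    intro i
    obtain ⟨a, b⟩ := aux_eig U d hU1 i
    have := h0 (U *ᵥ Pi.single i 1)
    have h' := h1 (U *ᵥ Pi.single i 1)
    rw [e, a] at this
    rw [e, a, b] at h'
    exact ⟨this, by linarith⟩
  rw [e, aux_exp_spectral U d hU1 hU2, aux_quad_spectral, Matrix.sub_mulVec, Matrix.one_mulVec,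
    Matrix.smul_mulVec, dotProduct_sub, dotProduct_smul, aux_quad_spectral,
    aux_norm_spectral U hU2, smul_eq_mul, Finset.mul_sum, ← Finset.sum_sub_distrib]
  refine Finset.sum_le_sum fun i _ => ?_
  have hx0 : 0 ≤ R⁻¹ * d i := mul_nonneg (by positivity) (hd i).1
  have hx1 : R⁻¹ * d i ≤ 1 := by rw [inv_mul_le_iff₀ hR]; linarith [(hd i).2]
  have hexp : Real.exp (-R⁻¹ * d i) ≤ 1 - (R⁻¹ * d i) / 2 := by
    set x := R⁻¹ * d i with hx
    have e1 : -R⁻¹ * d i = -x := by rw [hx]; ring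
    rw [e1, Real.exp_neg, inv_le_comm₀ (Real.exp_pos _) (by linarith)]
    have := Real.add_one_le_exp x
    refine le_trans ?_ this
    rw [inv_le_iff_one_le_mul₀ (by linarith)]
    nlinarith
  nlinarith [sq_nonneg ((Uᵀ *ᵥ v) i)]

lemma aux_exp_lower (A : Matrix ι ι ℝ) (hA : Aᵀ = A) (t s : ℝ) (ht : 0 < t) (v : ι → ℝ)
    (h1 : v ⬝ᵥ (A *ᵥ v) < s * (v ⬝ᵥ v)) :
    Real.exp (-t * s) ≤ trace (NormedSpace.exp ((-t) • A)) := by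
  obtain ⟨U, d, hU1, hU2, e⟩ := aux_spectral A hA
  have : ∃ i, d i < s := by
    by_contra hcon
    push Not at hcon
    rw [e, aux_quad_spectral, aux_norm_spectral U hU2, Finset.mul_sum] at h1
    exact absurd h1 (not_lt.mpr (Finset.sum_le_sum fun i _ => by
      exact mul_le_mul_of_nonneg_right (hcon i) (sq_nonneg _)))
  obtain ⟨i, hi⟩ := this
  rw [e, aux_exp_spectral U d hU1 hU2, Matrix.trace_mul_comm, ← mul_assoc, hU1, one_mul,
    Matrix.trace_diagonal]
  calc Real.exp (-t * s) ≤ Real.exp (-t * d i) := by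
        apply Real.exp_le_exp.mpr; nlinarith
    _ ≤ _ := Finset.single_le_sum (f := fun i => Real.exp (-t * d i)) (fun i _ => (Real.exp_pos _).le) (Finset.mem_univ i)

lemma aux_exp_sq (Y : Matrix ι ι ℝ) (hY : Yᵀ = Y) :
    ∃ B : Matrix ι ι ℝ, NormedSpace.exp Y = Bᵀ * B := by
  refine ⟨NormedSpace.exp (((2 : ℕ) : ℝ)⁻¹ • Y), ?_⟩
  rw [aux_symm_exp _ (by rw [Matrix.transpose_smul, hY]), ← pow_two]
  exact aux_exp_root Y 2 (by norm_num)

lemma aux_trace_sq_eq (B Q : Matrix ι ι ℝ) :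
    trace (Bᵀ * B * Q) = ∑ a, (B a) ⬝ᵥ (Q *ᵥ (B a)) := by
  rw [mul_assoc, Matrix.trace_mul_comm]
  simp only [trace, Matrix.diag, Matrix.mul_apply, dotProduct, Matrix.mulVec, Finset.sum_mul, Finset.mul_sum,
    Matrix.transpose_apply]
  refine Finset.sum_congr rfl fun a _ => ?_
  rw [Finset.sum_comm]
  exact Finset.sum_congr rfl fun i _ => Finset.sum_congr rfl fun j _ => by ring

lemma aux_trace_mono (Y Q Q' : Matrix ι ι ℝ) (hY : Yᵀ = Y)
    (h : ∀ v, v ⬝ᵥ (Q *ᵥ v) ≤ v ⬝ᵥ (Q' *ᵥ v)) :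
    trace (NormedSpace.exp Y * Q) ≤ trace (NormedSpace.exp Y * Q') := by
  obtain ⟨B, e⟩ := aux_exp_sq Y hY
  rw [e, aux_trace_sq_eq, aux_trace_sq_eq]
  exact Finset.sum_le_sum fun a _ => h _

lemma aux_trace_nonneg (Y : Matrix ι ι ℝ) (hY : Yᵀ = Y) : 0 ≤ trace (NormedSpace.exp Y) := by
  have := aux_trace_mono Y 0 1 hY (fun v => by
    simp only [Matrix.zero_mulVec, dotProduct_zero, Matrix.one_mulVec]
    exact Finset.sum_nonneg fun i _ => mul_self_nonneg _)
  simpa using this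

lemma aux_entry_le (Y : Matrix ι ι ℝ) (hY : Yᵀ = Y) (a b : ι) :
    |NormedSpace.exp Y a b| ≤ trace (NormedSpace.exp Y) := by
  obtain ⟨B, e⟩ := aux_exp_sq Y hY
  rw [e]
  have ht : trace (Bᵀ * B) = ∑ c, ∑ i, B i c ^ 2 := by
    simp [trace, Matrix.mul_apply, sq]
  have hs : ∀ c, ∑ i, B i c ^ 2 ≤ trace (Bᵀ * B) := fun c => by
    rw [ht]
    exact Finset.single_le_sum (f := fun c => ∑ i, B i c ^ 2) (fun i _ => by positivity) (Finset.mem_univ c)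
  simp only [Matrix.mul_apply, Matrix.transpose_apply]
  have h2 : 2 * |∑ i, B i a * B i b| ≤ ∑ i, B i a ^ 2 + ∑ i, B i b ^ 2 := by
    rw [← Finset.sum_add_distrib]
    refine (mul_le_mul_of_nonneg_left (Finset.abs_sum_le_sum_abs _ _) (by norm_num)).trans ?_
    rw [Finset.mul_sum]
    refine Finset.sum_le_sum fun j _ => ?_
    rw [abs_mul]
    nlinarith [sq_nonneg (|B j a| - |B j b|), sq_abs (B j a), sq_abs (B j b)]
  linarith [hs a, hs b]

lemma aux_exp_step (Y A : Matrix ι ι ℝ) (hY : Yᵀ = Y) (hA : Aᵀ = A) (R : ℝ) (hR : 0 < R)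
    (h0 : ∀ v, 0 ≤ v ⬝ᵥ (A *ᵥ v)) (h1 : ∀ v, v ⬝ᵥ (A *ᵥ v) ≤ R * (v ⬝ᵥ v)) :
    trace (NormedSpace.exp (Y + (-R⁻¹) • A)) ≤
      trace (NormedSpace.exp Y) - (R⁻¹ / 2) * trace (NormedSpace.exp Y * A) := by
  refine (aux_golden_thompson Y _ hY (by rw [Matrix.transpose_smul, hA])).trans ?_
  refine (aux_trace_mono Y _ _ hY (aux_exp_upper A hA R hR h0 h1)).trans (le_of_eq ?_)
  rw [mul_sub, mul_one, Matrix.trace_sub, Matrix.mul_smul, Matrix.trace_smul, smul_eq_mul]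
end Spec


section Chernoff
variable {ι : Type*} [Fintype ι] [DecidableEq ι]

lemma aux_chernoff0 {Ω : Type*} [MeasurableSpace Ω] (P : Measure Ω) [IsProbabilityMeasure P]
    (Z : ℕ → Ω → ι → ι → ℝ) (hZm : ∀ j, Measurable (Z j)) (hind : iIndepFun Z P)
    (R : ℝ) (hR : 0 < R) (hsymm : ∀ j ω, (Matrix.of (Z j ω))ᵀ = Matrix.of (Z j ω))
    (h0 : ∀ j ω v, 0 ≤ v ⬝ᵥ (Matrix.of (Z j ω) *ᵥ v))
    (h1 : ∀ j ω v, v ⬝ᵥ (Matrix.of (Z j ω) *ᵥ v) ≤ R * (v ⬝ᵥ v))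
    (hZi : ∀ j a b, Integrable (fun ω => Z j ω a b) P)
    (hE : ∀ j a b, ∫ ω, Z j ω a b ∂P = if a = b then 1 else 0) (n : ℕ) :
    Integrable (fun ω => trace (NormedSpace.exp ((-R⁻¹) • ∑ j ∈ Finset.range n, Matrix.of (Z j ω)))) P ∧
    ∫ ω, trace (NormedSpace.exp ((-R⁻¹) • ∑ j ∈ Finset.range n, Matrix.of (Z j ω))) ∂P
      ≤ Fintype.card ι * (1 - R⁻¹ / 2) ^ n := by
  have hR' : 0 < R⁻¹ := inv_pos.mpr hR
  -- sums
  have hSe : ∀ n ω, ∑ j ∈ Finset.range n, Matrix.of (Z j ω) = Matrix.of ((∑ j ∈ Finset.range n, Z j) ω) := by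
    intro n ω
    ext a b
    simp [Matrix.sum_apply, Finset.sum_apply]
  set g : (ι → ι → ℝ) → Matrix ι ι ℝ := fun z => NormedSpace.exp ((-R⁻¹) • Matrix.of z) with hg
  have hgc : Continuous g := by
    have h1 : Continuous (fun z : ι → ι → ℝ => (Matrix.of z : Matrix ι ι ℝ)) := continuous_id
    have h2 : Continuous (fun z : ι → ι → ℝ => (-R⁻¹) • (Matrix.of z : Matrix ι ι ℝ)) :=
      h1.const_smul (-R⁻¹)
    exact aux_exp_continuous.comp h2
  have hgm : ∀ a b, Measurable (fun z => g z a b) := fun a b => (hgc.matrix_elem a b).measurable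
  have hSm : ∀ n, Measurable (∑ j ∈ Finset.range n, Z j) := fun n =>
    by
      have := Finset.measurable_sum (Finset.range n) fun j _ => hZm j
      convert! this using 1
      ext ω; simp
  have hSsymm : ∀ n ω, (Matrix.of ((∑ j ∈ Finset.range n, Z j) ω))ᵀ = Matrix.of ((∑ j ∈ Finset.range n, Z j) ω) := by
    intro n ω
    rw [← hSe, Matrix.transpose_sum]
    exact Finset.sum_congr rfl fun j _ => hsymm j ω
  have hYsymm : ∀ n ω, ((-R⁻¹) • Matrix.of ((∑ j ∈ Finset.range n, Z j) ω))ᵀ = (-R⁻¹) • Matrix.of ((∑ j ∈ Finset.range n, Z j) ω) := by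
    intro n ω
    rw [Matrix.transpose_smul, hSsymm]
  have hstep : ∀ n ω, trace (g ((∑ j ∈ Finset.range (n + 1), Z j) ω)) ≤
      trace (g ((∑ j ∈ Finset.range n, Z j) ω)) -
        (R⁻¹ / 2) * trace (g ((∑ j ∈ Finset.range n, Z j) ω) * Matrix.of (Z n ω)) := by
    intro n ω
    have := aux_exp_step ((-R⁻¹) • Matrix.of ((∑ j ∈ Finset.range n, Z j) ω)) (Matrix.of (Z n ω))
      (hYsymm n ω) (hsymm n ω) R hR (h0 n ω) (h1 n ω)
    rw [← smul_add] at this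
    have e : Matrix.of ((∑ j ∈ Finset.range n, Z j) ω) + Matrix.of (Z n ω) =
        Matrix.of ((∑ j ∈ Finset.range (n + 1), Z j) ω) := by
      rw [Finset.sum_range_succ]; rfl
    rw [e] at this
    exact this
  have hnn : ∀ n ω, 0 ≤ trace (g ((∑ j ∈ Finset.range n, Z j) ω)) := fun n ω => aux_trace_nonneg _ (hYsymm n ω)
  have hpos : ∀ n ω, 0 ≤ trace (g ((∑ j ∈ Finset.range n, Z j) ω) * Matrix.of (Z n ω)) := by
    intro n ω
    have := aux_trace_mono ((-R⁻¹) • Matrix.of ((∑ j ∈ Finset.range n, Z j) ω)) 0 (Matrix.of (Z n ω))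
      (hYsymm n ω) (fun v => by simpa using h0 n ω v)
    rw [mul_zero, Matrix.trace_zero] at this
    exact this
  have hbd : ∀ n ω, trace (g ((∑ j ∈ Finset.range n, Z j) ω)) ≤ Fintype.card ι := by
    intro n ω
    induction n with
    | zero =>
      have e0 : Matrix.of (0 : ι → ι → ℝ) = 0 := rfl
      simp [hg, e0]
    | succ n ih => nlinarith [hstep n ω, hpos n ω, mul_nonneg hR'.le (hpos n ω)]
  have hent : ∀ n a b, Integrable (fun ω => g ((∑ j ∈ Finset.range n, Z j) ω) a b) P := by
    intro n a b
    refine Integrable.of_bound ((hgm a b).comp (hSm n)).aestronglyMeasurable (Fintype.card ι) ?_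
    refine Eventually.of_forall fun ω => ?_
    exact (aux_entry_le _ (hYsymm n ω) a b).trans (hbd n ω)
  have htr : ∀ n, Integrable (fun ω => trace (g ((∑ j ∈ Finset.range n, Z j) ω))) P := fun n =>
    integrable_finsetSum _ fun a _ => hent n a a
  have hindep : ∀ n a b, IndepFun (fun ω => g ((∑ j ∈ Finset.range n, Z j) ω) a b) (fun ω => Z n ω b a) P := by
    intro n a b
    have h := hind.indepFun_finsetSum_of_notMem hZm (s := Finset.range n) (i := n) (by simp)
    exact h.comp (hgm a b) (ψ := fun z : ι → ι → ℝ => z b a)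
      ((measurable_pi_apply a).comp (measurable_pi_apply b))
  have hterm : ∀ n a b, Integrable (fun ω => g ((∑ j ∈ Finset.range n, Z j) ω) a b * Z n ω b a) P :=
    fun n a b => (hindep n a b).integrable_mul (hent n a b) (hZi n b a)
  have hprod : ∀ n ω, trace (g ((∑ j ∈ Finset.range n, Z j) ω) * Matrix.of (Z n ω)) =
      ∑ a, ∑ b, g ((∑ j ∈ Finset.range n, Z j) ω) a b * Z n ω b a := by
    intro n ω; simp [trace, Matrix.mul_apply]
  have hint2 : ∀ n, Integrable (fun ω => trace (g ((∑ j ∈ Finset.range n, Z j) ω) * Matrix.of (Z n ω))) P := by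
    intro n
    simp only [hprod]
    exact integrable_finsetSum _ fun a _ => integrable_finsetSum _ fun b _ => hterm n a b
  have hval : ∀ n, ∫ ω, trace (g ((∑ j ∈ Finset.range n, Z j) ω) * Matrix.of (Z n ω)) ∂P =
      ∫ ω, trace (g ((∑ j ∈ Finset.range n, Z j) ω)) ∂P := by
    intro n
    simp only [hprod]
    rw [integral_finsetSum _ fun a _ => integrable_finsetSum _ fun b _ => hterm n a b]
    simp only [trace, Matrix.diag]
    rw [integral_finsetSum _ fun a _ => hent n a a]
    refine Finset.sum_congr rfl fun a _ => ?_
    rw [integral_finsetSum _ fun b _ => hterm n a b]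
    rw [Finset.sum_eq_single a]
    · rw [(hindep n a a).integral_fun_mul_eq_mul_integral (hent n a a).aestronglyMeasurable (hZi n a a).aestronglyMeasurable, hE]
      simp
    · intro b _ hb
      rw [(hindep n a b).integral_fun_mul_eq_mul_integral (hent n a b).aestronglyMeasurable (hZi n b a).aestronglyMeasurable, hE]
      simp [hb]
    · simp
  simp only [hSe]
  refine ⟨htr n, ?_⟩
  have hR2 : Nonempty ι → R⁻¹ ≤ 1 := by
    rintro ⟨a⟩
    have e1 := hE 0 a a
    have e2 : ∫ ω, Z 0 ω a a ∂P ≤ ∫ ω, R ∂P := by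
      refine integral_mono (hZi 0 a a) (integrable_const _) fun ω => ?_
      have := h1 0 ω (Pi.single a 1)
      simpa using this
    simp [e1] at e2
    exact inv_le_one_of_one_le₀ e2
  rcases isEmpty_or_nonempty ι with hemp | hne
  · simp [trace]
  have hR3 := hR2 hne
  induction n with
  | zero =>
    have e0 : Matrix.of (0 : ι → ι → ℝ) = 0 := rfl
    simp [e0]
  | succ n ih =>
    have : ∫ ω, trace (g ((∑ j ∈ Finset.range (n + 1), Z j) ω)) ∂P ≤
        (1 - R⁻¹ / 2) * ∫ ω, trace (g ((∑ j ∈ Finset.range n, Z j) ω)) ∂P := by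
      calc _ ≤ ∫ ω, (trace (g ((∑ j ∈ Finset.range n, Z j) ω)) -
        (R⁻¹ / 2) * trace (g ((∑ j ∈ Finset.range n, Z j) ω) * Matrix.of (Z n ω))) ∂P :=
            integral_mono (htr _) ((htr n).sub ((hint2 n).const_mul _)) fun ω => hstep n ω
        _ = _ := by
            rw [integral_sub (htr n) ((hint2 n).const_mul _), integral_const_mul, hval]; ring
    refine this.trans ((mul_le_mul_of_nonneg_left ih (by linarith)).trans (le_of_eq ?_))
    rw [pow_succ]; ring

lemma aux_chernoff1 {Ω : Type*} [MeasurableSpace Ω] (P : Measure Ω) [IsProbabilityMeasure P]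
    (Z : ℕ → Ω → ι → ι → ℝ) (hZm : ∀ j, Measurable (Z j)) (hind : iIndepFun Z P)
    (R : ℝ) (hR : 0 < R) (hsymm : ∀ j ω, (Matrix.of (Z j ω))ᵀ = Matrix.of (Z j ω))
    (h0 : ∀ j ω v, 0 ≤ v ⬝ᵥ (Matrix.of (Z j ω) *ᵥ v))
    (h1 : ∀ j ω v, v ⬝ᵥ (Matrix.of (Z j ω) *ᵥ v) ≤ R * (v ⬝ᵥ v))
    (hZi : ∀ j a b, Integrable (fun ω => Z j ω a b) P)
    (hE : ∀ j a b, ∫ ω, Z j ω a b ∂P = if a = b then 1 else 0) (n : ℕ) :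
    P {ω | ∃ v, v ⬝ᵥ ((∑ j ∈ Finset.range n, Matrix.of (Z j ω)) *ᵥ v) < n / 4 * (v ⬝ᵥ v)} ≤
      ENNReal.ofReal (Fintype.card ι * Real.exp (-(n / (4 * R)))) := by
  obtain ⟨hi, hle⟩ := aux_chernoff0 P Z hZm hind R hR hsymm h0 h1 hZi hE n
  have hR' : 0 < R⁻¹ := inv_pos.mpr hR
  have hSsymm : ∀ ω, (∑ j ∈ Finset.range n, Matrix.of (Z j ω))ᵀ = ∑ j ∈ Finset.range n, Matrix.of (Z j ω) := by
    intro ω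
    rw [Matrix.transpose_sum]
    exact Finset.sum_congr rfl fun j _ => hsymm j ω
  have hmk := mul_meas_ge_le_integral_of_nonneg (Eventually.of_forall fun ω => aux_trace_nonneg
    ((-R⁻¹) • ∑ j ∈ Finset.range n, Matrix.of (Z j ω)) (by rw [Matrix.transpose_smul, hSsymm])) hi
    (Real.exp (-R⁻¹ * (n / 4)))
  have hsub : {ω | ∃ v, v ⬝ᵥ ((∑ j ∈ Finset.range n, Matrix.of (Z j ω)) *ᵥ v) < n / 4 * (v ⬝ᵥ v)} ⊆
    {ω | Real.exp (-R⁻¹ * (n / 4)) ≤ trace (NormedSpace.exp ((-R⁻¹) • ∑ j ∈ Finset.range n, Matrix.of (Z j ω)))} := by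
    rintro ω ⟨v, hv⟩
    exact aux_exp_lower _ (hSsymm ω) R⁻¹ _ hR' v hv
  refine (measure_mono hsub).trans ?_
  rw [← ofReal_measureReal]
  apply ENNReal.ofReal_le_ofReal
  have hpow : (1 - R⁻¹ / 2) ^ n ≤ Real.exp (-R⁻¹ / 2 * n) ∨ IsEmpty ι := by
    rcases isEmpty_or_nonempty ι with hemp | ⟨⟨a⟩⟩
    · exact Or.inr hemp
    left
    have e1 := hE 0 a a
    have e2 : ∫ ω, Z 0 ω a a ∂P ≤ ∫ ω, R ∂P := by
      refine integral_mono (hZi 0 a a) (integrable_const _) fun ω => ?_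
      have := h1 0 ω (Pi.single a 1)
      simpa using this
    simp [e1] at e2
    have := inv_le_one_of_one_le₀ e2
    calc (1 - R⁻¹ / 2) ^ n ≤ (Real.exp (-R⁻¹ / 2)) ^ n := by
          gcongr
          · linarith
          · have := Real.add_one_le_exp (-R⁻¹ / 2); linarith
      _ = _ := by rw [← Real.exp_nat_mul]; congr 1; ring
  have hfin := hmk.trans hle
  have hfin2 : Real.exp (-R⁻¹ * (n / 4)) * P.real {ω | Real.exp (-R⁻¹ * (n / 4)) ≤ trace (NormedSpace.exp ((-R⁻¹) • ∑ j ∈ Finset.range n, Matrix.of (Z j ω)))} ≤ Fintype.card ι * Real.exp (-R⁻¹ / 2 * n) := by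
    rcases hpow with h | h
    · exact hfin.trans (by gcongr)
    · refine hfin.trans (le_of_eq ?_); simp
  have e3 : Real.exp (-R⁻¹ / 2 * n) = Real.exp (-R⁻¹ * (n / 4)) * Real.exp (-(n / (4 * R))) := by
    rw [← Real.exp_add]; congr 1; field_simp; ring
  rw [e3] at hfin2
  have hp := Real.exp_pos (-R⁻¹ * (n / 4))
  refine le_of_mul_le_mul_left (hfin2.trans (le_of_eq ?_)) hp
  ring

lemma aux_chernoff2 {𝓧 Ω : Type*} [MeasurableSpace 𝓧] [MeasurableSpace Ω] (P : Measure Ω) [IsProbabilityMeasure P]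
    (μ : Measure 𝓧) (X : ℕ → Ω → 𝓧) (hX_meas : ∀ i, Measurable (X i))
    (hX_indep : iIndepFun X P) (hX_id : ∀ i, P.map (X i) = μ)
    (F : 𝓧 → ι → ι → ℝ) (hF : ∀ a b, AEMeasurable (fun x => F x a b) μ) (R : ℝ) (hR : 0 < R)
    (hgood : ∀ᵐ x ∂μ, (Matrix.of (F x))ᵀ = Matrix.of (F x) ∧ (∀ v, 0 ≤ v ⬝ᵥ (Matrix.of (F x) *ᵥ v)) ∧
      (∀ v, v ⬝ᵥ (Matrix.of (F x) *ᵥ v) ≤ R * (v ⬝ᵥ v)))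
    (hFi : ∀ a b, Integrable (fun x => F x a b) μ)
    (hE : ∀ a b, ∫ x, F x a b ∂μ = if a = b then 1 else 0) (n : ℕ) :
    P {ω | ∃ v, v ⬝ᵥ ((∑ j ∈ Finset.range n, Matrix.of (F (X j ω))) *ᵥ v) < n / 4 * (v ⬝ᵥ v)} ≤
      ENNReal.ofReal (Fintype.card ι * Real.exp (-(n / (4 * R)))) := by
  classical
  have hF2 : AEMeasurable F μ := aemeasurable_pi_lambda _ fun a => aemeasurable_pi_lambda _ fun b => hF a b
  obtain ⟨G, hGm, hFG⟩ := hF2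
  have hall := hgood.and hFG
  set N := toMeasurable μ {x | ¬ (((Matrix.of (F x))ᵀ = Matrix.of (F x) ∧ (∀ v, 0 ≤ v ⬝ᵥ (Matrix.of (F x) *ᵥ v)) ∧
      (∀ v, v ⬝ᵥ (Matrix.of (F x) *ᵥ v) ≤ R * (v ⬝ᵥ v))) ∧ F x = G x)} with hN
  have hN0 : μ N = 0 := by rw [hN, measure_toMeasurable]; exact hall
  have hNm : MeasurableSet N := measurableSet_toMeasurable _ _
  have hnot : ∀ x, x ∉ N → ((Matrix.of (F x))ᵀ = Matrix.of (F x) ∧ (∀ v, 0 ≤ v ⬝ᵥ (Matrix.of (F x) *ᵥ v)) ∧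
      (∀ v, v ⬝ᵥ (Matrix.of (F x) *ᵥ v) ≤ R * (v ⬝ᵥ v))) ∧ F x = G x := by
    intro x hx
    by_contra hcon
    exact hx (subset_toMeasurable _ _ hcon)
  set H : 𝓧 → ι → ι → ℝ := fun x => if x ∈ N then 0 else G x with hH
  have hHm : Measurable H := Measurable.ite hNm measurable_const hGm
  have hHF : ∀ x, x ∉ N → H x = F x := fun x hx => by simp [hH, hx, (hnot x hx).2]
  have haeN : ∀ᵐ x ∂μ, x ∉ N := measure_eq_zero_iff_ae_notMem.mp hN0
  have hHFae : ∀ᵐ x ∂μ, H x = F x := haeN.mono hHF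
  have e0 : Matrix.of (0 : ι → ι → ℝ) = 0 := rfl
  have hHgood : ∀ x, (Matrix.of (H x))ᵀ = Matrix.of (H x) ∧ (∀ v, 0 ≤ v ⬝ᵥ (Matrix.of (H x) *ᵥ v)) ∧
      (∀ v, v ⬝ᵥ (Matrix.of (H x) *ᵥ v) ≤ R * (v ⬝ᵥ v)) := by
    intro x
    by_cases hx : x ∈ N
    · have : H x = 0 := by simp [hH, hx]
      rw [this, e0]
      refine ⟨by simp, by simp, fun v => ?_⟩
      simp only [Matrix.zero_mulVec, dotProduct_zero]
      exact mul_nonneg hR.le (Finset.sum_nonneg fun i _ => mul_self_nonneg _)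
    · rw [hHF x hx]; exact (hnot x hx).1
  have hHint : ∀ a b, Integrable (fun x => H x a b) μ := fun a b =>
    (hFi a b).congr (hHFae.mono fun x hx => by simp [hx])
  have hmeasab : ∀ a b, Measurable (fun x => H x a b) := fun a b =>
    (measurable_pi_apply b).comp ((measurable_pi_apply a).comp hHm)
  have key := aux_chernoff1 P (fun j ω => H (X j ω)) (fun j => hHm.comp (hX_meas j))
    (hX_indep.comp (fun _ => H) fun _ => hHm) R hR (fun j ω => (hHgood _).1)
    (fun j ω => (hHgood _).2.1) (fun j ω => (hHgood _).2.2) ?_ ?_ n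
  · refine le_trans (measure_mono_ae ?_) key
    have : ∀ᵐ ω ∂P, ∀ j, H (X j ω) = F (X j ω) := by
      rw [ae_all_iff]
      intro j
      exact ae_of_ae_map (hX_meas j).aemeasurable (by rw [hX_id j]; exact hHFae)
    filter_upwards [this] with ω hω hv
    obtain ⟨v, hv⟩ := hv
    refine ⟨v, ?_⟩
    simp only [hω]
    exact hv
  · intro j a b
    have := hHint a b
    rw [← hX_id j] at this
    exact this.comp_measurable (hX_meas j)
  · intro j a b
    have := integral_map (hX_meas j).aemeasurable (f := fun x => H x a b) (hmeasab a b).aestronglyMeasurable (μ := P)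
    rw [← this, hX_id j, ← hE a b]
    exact integral_congr_ae (hHFae.mono fun x hx => by simp [hx])
end Chernoff


section Meas
variable {𝓧 : Type*} [MeasurableSpace 𝓧]

lemma aux_sq_integrable (μ : Measure 𝓧) (ef : ℕ → 𝓧 → ℝ)
    (horth : ∀ i j, ∫ t, ef i t * ef j t ∂μ = if i = j then (1 : ℝ) else 0) (i : ℕ) :
    Integrable (fun t => ef i t ^ 2) μ := by
  by_contra h
  have h1 := horth i i
  have h2 := integral_undef h
  simp only [sq] at h2
  rw [h2] at h1
  simp at h1

lemma aux_ae_summable (μ : Measure 𝓧) (ef : ℕ → 𝓧 → ℝ)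
    (horth : ∀ i j, ∫ t, ef i t * ef j t ∂μ = if i = j then (1 : ℝ) else 0)
    (w : ℕ → ℝ) (hw : ∀ i, 0 ≤ w i) (hs : Summable w) :
    ∀ᵐ x ∂μ, Summable fun i => w i * ef i x ^ 2 := by
  have hIntg : ∀ i, Integrable (fun t => w i * ef i t ^ 2) μ := fun i =>
    (aux_sq_integrable μ ef horth i).const_mul _
  have hnn : ∀ i t, 0 ≤ w i * ef i t ^ 2 := fun i t => mul_nonneg (hw i) (sq_nonneg _)
  have hval : ∀ i, ∫⁻ t, ENNReal.ofReal (w i * ef i t ^ 2) ∂μ = ENNReal.ofReal (w i) := by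
    intro i
    rw [← ofReal_integral_eq_lintegral_ofReal (hIntg i) (Eventually.of_forall (hnn i)),
      integral_const_mul]
    have := horth i i
    simp only [if_true] at this
    simp only [sq, this, mul_one]
  have hlt : ∫⁻ t, ∑' i, ENNReal.ofReal (w i * ef i t ^ 2) ∂μ ≠ ⊤ := by
    rw [lintegral_tsum fun i => (hIntg i).aemeasurable.ennreal_ofReal]
    simp only [hval]
    rw [← ENNReal.ofReal_tsum_of_nonneg hw hs]
    exact ENNReal.ofReal_ne_top
  have := ae_lt_top' (AEMeasurable.tsum fun i => (hIntg i).aemeasurable.ennreal_ofReal) hlt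
  filter_upwards [this] with x hx
  have h3 := ENNReal.summable_toReal hx.ne
  refine h3.congr fun i => ?_
  rw [ENNReal.toReal_ofReal (hnn i x)]

lemma aux_prod_aemeasurable [TopologicalSpace 𝓧] [SecondCountableTopology 𝓧] (μ : Measure 𝓧)
    (k : 𝓧 → 𝓧 → ℝ) (hk_cont : Continuous (Function.uncurry k))
    (ev : ℕ → ℝ) (ef : ℕ → 𝓧 → ℝ) (hev_pos : ∀ i, 0 < ev i)
    (horth : ∀ i j, ∫ t, ef i t * ef j t ∂μ = if i = j then (1 : ℝ) else 0)
    (hmercer : ∀ x y, k x y = ∑' i, ev i * ef i x * ef i y)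
    (heig : ∀ i x, ∫ y, k x y * ef i y ∂μ = ev i * ef i x)
    (hgood : ∀ᵐ x ∂μ, Summable fun i => ev i * ef i x ^ 2) (i j : ℕ) :
    AEMeasurable (fun t => ef i t * ef j t) μ := by
  classical
  set S : Set 𝓧 := {x | ef i x ≠ 0 ∧ ef j x ≠ 0} with hS
  by_cases hne : Nonempty S
  swap
  · have : (fun t => ef i t * ef j t) = fun _ => 0 := by
      funext t
      by_contra hc
      have hc : ef i t * ef j t ≠ 0 := hc
      exact hne ⟨⟨t, left_ne_zero_of_mul hc, right_ne_zero_of_mul hc⟩⟩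
    rw [this]; exact aemeasurable_const
  have hu : ∀ m, (x : 𝓧) → ef m x ≠ 0 → AEMeasurable (fun y => k x y * ef m y) μ := by
    intro m x hx
    by_cases h : Integrable (fun y => k x y * ef m y) μ
    · exact h.aemeasurable
    · have h2 := integral_undef h
      rw [heig] at h2
      exact absurd h2 (mul_ne_zero (hev_pos m).ne' hx)
  let xs : ℕ → S := TopologicalSpace.denseSeq S
  let h : ℕ → 𝓧 → ℝ := fun l y => ef i y ^ 2 * ((k (xs l) y * ef j y) / (k (xs l) y * ef i y))
  have hh : ∀ l, AEMeasurable (h l) μ := fun l =>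
    (aux_sq_integrable μ ef horth i).aemeasurable.mul
      ((hu j _ (xs l).2.2).div (hu i _ (xs l).2.1))
  have hhv : ∀ l y, h l y = if k (xs l) y = 0 then 0 else ef i y * ef j y := by
    intro l y
    simp only [h]
    split_ifs with hk
    · simp [hk]
    · by_cases hi : ef i y = 0
      · simp [hi]
      · field_simp
  let φ : ℝ × ℝ → ℝ := fun p => if p.1 = 0 then p.2 else p.1
  have hφ : Measurable φ := Measurable.ite (measurable_fst (measurableSet_singleton 0)) measurable_snd measurable_fst
  let g : ℕ → 𝓧 → ℝ := fun N => Nat.rec (motive := fun _ => 𝓧 → ℝ) (fun _ => 0) (fun n g y => φ (g y, h n y)) N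
  have hg : ∀ N, AEMeasurable (g N) μ := by
    intro N
    induction N with
    | zero => exact aemeasurable_const
    | succ n ih => exact hφ.comp_aemeasurable (ih.prodMk (hh n))
  have hgs : ∀ N y, g (N + 1) y = if g N y = 0 then h N y else g N y := fun N y => rfl
  have hg01 : ∀ N y, g N y = 0 ∨ g N y = ef i y * ef j y := by
    intro N y
    induction N with
    | zero => left; rfl
    | succ n ih =>
      rw [hgs, hhv]
      split_ifs <;> simp_all
  refine aemeasurable_of_tendsto_metrizable_ae atTop hg ?_
  filter_upwards [hgood] with y hy
  by_cases hyS : y ∈ S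
  · have hkyy : k y y ≠ 0 := by
      rw [hmercer]
      have hsum : Summable fun m => ev m * ef m y * ef m y := hy.congr fun m => by ring
      have : ev i * ef i y * ef i y ≤ ∑' m, ev m * ef m y * ef m y :=
        hsum.le_tsum i fun m _ => by
          have := mul_nonneg (hev_pos m).le (mul_self_nonneg (ef m y)); rwa [mul_assoc]
      have h2 : 0 < ev i * ef i y * ef i y := by
        rw [mul_assoc]; exact mul_pos (hev_pos i) (mul_self_pos.mpr hyS.1)
      exact (h2.trans_le this).ne'
    have hopen : IsOpen {z : S | k z y ≠ 0} := by
      have : Continuous fun z : S => k z y :=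
        hk_cont.comp (continuous_subtype_val.prodMk continuous_const)
      exact isOpen_ne.preimage this
    obtain ⟨z, hz1, l, hl⟩ := (TopologicalSpace.denseRange_denseSeq S).inter_open_nonempty _ hopen ⟨⟨y, hyS⟩, hkyy⟩
    have hkl : k (xs l) y ≠ 0 := by
      have : xs l = z := hl
      rw [this]; exact hz1
    have hfin : ∀ N, g (l + 1 + N) y = ef i y * ef j y := by
      intro N
      induction N with
      | zero =>
        rw [add_zero, hgs, hhv, if_neg hkl]
        split_ifs with h0
        · rfl
        · exact (hg01 l y).resolve_left h0
      | succ n ih =>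
        rw [← add_assoc, hgs, ih]
        rw [if_neg (mul_ne_zero hyS.1 hyS.2)]
    refine tendsto_const_nhds.congr' ?_
    filter_upwards [eventually_ge_atTop (l + 1)] with N hN
    obtain ⟨m, rfl⟩ := Nat.exists_eq_add_of_le hN
    exact (hfin m).symm
  · have h0 : ef i y * ef j y = 0 := by
      by_contra hc
      exact hyS ⟨left_ne_zero_of_mul hc, right_ne_zero_of_mul hc⟩
    refine tendsto_const_nhds.congr fun N => ?_
    rcases hg01 N y with h1 | h1 <;> rw [h1, h0]

lemma aux_prod_integrable (μ : Measure 𝓧) (ef : ℕ → 𝓧 → ℝ)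
    (horth : ∀ i j, ∫ t, ef i t * ef j t ∂μ = if i = j then (1 : ℝ) else 0)
    (hm : ∀ i j, AEMeasurable (fun t => ef i t * ef j t) μ) (i j : ℕ) :
    Integrable (fun t => ef i t * ef j t) μ := by
  refine Integrable.mono' ((aux_sq_integrable μ ef horth i).add (aux_sq_integrable μ ef horth j))
    (hm i j).aestronglyMeasurable (Eventually.of_forall fun t => ?_)
  simp only [Pi.add_apply, Real.norm_eq_abs]
  rw [abs_mul]
  nlinarith [sq_nonneg (|ef i t| - |ef j t|), sq_abs (ef i t), sq_abs (ef j t), sq_nonneg (ef i t), sq_nonneg (ef j t)]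

lemma aux_summable_mercer (ev : ℕ → ℝ) (hev_pos : ∀ i, 0 < ev i) (a b : ℕ → ℝ)
    (ha : Summable fun i => ev i * a i ^ 2) (hb : Summable fun i => ev i * b i ^ 2) :
    Summable fun i => ev i * a i * b i := by
  refine Summable.of_norm_bounded (ha.add hb) fun i => ?_
  rw [Real.norm_eq_abs, abs_mul, abs_mul, abs_of_pos (hev_pos i), mul_assoc, ← mul_add]
  refine mul_le_mul_of_nonneg_left ?_ (hev_pos i).le
  nlinarith [sq_nonneg (|a i| - |b i|), sq_abs (a i), sq_abs (b i), sq_nonneg (a i), sq_nonneg (b i)]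

lemma aux_kk (μ : Measure 𝓧) [IsProbabilityMeasure μ]
    (k : 𝓧 → 𝓧 → ℝ) (hk_symm : ∀ x y, k x y = k y x) (B : ℝ) (hB : ∀ x y, |k x y| ≤ B)
    (ev : ℕ → ℝ) (ef : ℕ → 𝓧 → ℝ) (hev_pos : ∀ i, 0 < ev i) (hev_sum : Summable ev)
    (horth : ∀ i j, ∫ t, ef i t * ef j t ∂μ = if i = j then (1 : ℝ) else 0)
    (hmercer : ∀ x y, k x y = ∑' i, ev i * ef i x * ef i y)
    (heig : ∀ i x, ∫ y, k x y * ef i y ∂μ = ev i * ef i x)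
    (hgood : ∀ᵐ x ∂μ, Summable fun i => ev i * ef i x ^ 2)
    (hm : ∀ i j, AEMeasurable (fun t => ef i t * ef j t) μ)
    (x y : 𝓧) (hx : Summable fun i => ev i * ef i x ^ 2) (hy : Summable fun i => ev i * ef i y ^ 2) :
    Integrable (fun t => k t x * k t y) μ ∧
      HasSum (fun m => ev m ^ 2 * ef m x * ef m y) (∫ t, k t x * k t y ∂μ) := by
  have hB0 : 0 ≤ B := (abs_nonneg _).trans (hB x x)
  have lim : ∀ (F : ℕ → 𝓧 → ℝ) (G : 𝓧 → ℝ), (∀ m, AEMeasurable (F m) μ) →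
      (∀ᵐ t ∂μ, HasSum (fun m => F m t) (G t)) → AEMeasurable G μ := by
    intro F G hF hG
    refine aemeasurable_of_tendsto_metrizable_ae atTop (f := fun N t => ∑ m ∈ Finset.range N, F m t)
      (fun N => Finset.aemeasurable_fun_sum _ fun m _ => hF m) ?_
    filter_upwards [hG] with t ht using ht.tendsto_sum_nat
  have hkx : ∀ m, AEMeasurable (fun t => k t x * ef m t) μ := by
    intro m
    refine lim (fun l t => ev l * ef l x * (ef l t * ef m t)) _ (fun l => (hm l m).const_mul _) ?_
    filter_upwards [hgood] with t ht
    have h1 := (aux_summable_mercer ev hev_pos (fun i => ef i t) (fun i => ef i x) ht hx).hasSum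
    rw [← hmercer] at h1
    refine (h1.mul_right (ef m t)).congr_fun fun l => by ring
  have hkkm : AEMeasurable (fun t => k t x * k t y) μ := by
    refine lim (fun m t => ev m * ef m y * (k t x * ef m t)) _ (fun m => (hkx m).const_mul _) ?_
    filter_upwards [hgood] with t ht
    have h1 := (aux_summable_mercer ev hev_pos (fun i => ef i t) (fun i => ef i y) ht hy).hasSum
    rw [← hmercer] at h1
    refine (h1.mul_left (k t x)).congr_fun fun l => by ring
  have hkxb : ∀ m t, ‖k t x * ef m t‖ ≤ B * (1 + ef m t ^ 2) := by
    intro m t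
    rw [norm_mul, Real.norm_eq_abs, Real.norm_eq_abs]
    refine mul_le_mul (hB _ _) ?_ (abs_nonneg _) hB0
    nlinarith [sq_nonneg (|ef m t| - 1), sq_abs (ef m t)]
  have hdom : ∀ m, Integrable (fun t => B * (1 + ef m t ^ 2)) μ := fun m =>
    ((integrable_const 1).add (aux_sq_integrable μ ef horth m)).const_mul B
  have hkxi : ∀ m, Integrable (fun t => k t x * ef m t) μ := fun m =>
    Integrable.mono' (hdom m) (hkx m).aestronglyMeasurable (Eventually.of_forall (hkxb m))
  have hkxI : ∀ m, ∫ t, ‖k t x * ef m t‖ ∂μ ≤ 2 * B := by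
    intro m
    refine (integral_mono (hkxi m).norm (hdom m) (hkxb m)).trans ?_
    rw [integral_const_mul, integral_add (integrable_const 1) (aux_sq_integrable μ ef horth m)]
    have := horth m m
    simp only [if_true] at this
    simp only [sq, this]
    simp
    linarith
  constructor
  · refine Integrable.of_bound hkkm.aestronglyMeasurable (B * B) (Eventually.of_forall fun t => ?_)
    rw [norm_mul]
    exact mul_le_mul (hB _ _) (hB _ _) (norm_nonneg _) hB0
  · have h1 := hasSum_integral_of_summable_integral_norm (μ := μ)
      (F := fun m t => ev m * ef m y * (k t x * ef m t)) (fun m => (hkxi m).const_mul _) ?_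
    · have e1 : ∫ t, ∑' m, ev m * ef m y * (k t x * ef m t) ∂μ = ∫ t, k t x * k t y ∂μ := by
        refine integral_congr_ae ?_
        filter_upwards [hgood] with t ht
        have h1 := (aux_summable_mercer ev hev_pos (fun i => ef i t) (fun i => ef i y) ht hy).hasSum
        rw [← hmercer] at h1
        exact ((h1.mul_left (k t x)).congr_fun fun l => by ring).tsum_eq
      rw [e1] at h1
      refine h1.congr_fun fun m => ?_
      rw [integral_const_mul]
      simp only [hk_symm _ x]
      rw [heig]; ring
    · refine Summable.of_nonneg_of_le (fun m => integral_nonneg fun t => norm_nonneg _) (fun m => ?_)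
        (((hev_sum.add hy)).mul_right (2 * B))
      have : ∀ t, ‖ev m * ef m y * (k t x * ef m t)‖ = (ev m * |ef m y|) * ‖k t x * ef m t‖ := by
        intro t
        rw [norm_mul, norm_mul, Real.norm_eq_abs, Real.norm_eq_abs, abs_of_pos (hev_pos m)]
      simp only [this]
      rw [integral_const_mul]
      refine mul_le_mul ?_ (hkxI m) (integral_nonneg fun t => norm_nonneg _) ?_
      · nlinarith [sq_nonneg (|ef m y| - 1), sq_abs (ef m y), hev_pos m]
      · have := mul_nonneg (hev_pos m).le (sq_nonneg (ef m y))
        linarith [(hev_pos m).le]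
end Meas


section Det
variable {n : ℕ}

lemma aux_dot_self_nonneg (v : Fin n → ℝ) : 0 ≤ v ⬝ᵥ v := Finset.sum_nonneg fun _ _ => mul_self_nonneg _

lemma aux_dot_cs (a b : Fin n → ℝ) : (a ⬝ᵥ b) ^ 2 ≤ (a ⬝ᵥ a) * (b ⬝ᵥ b) := by
  have := Finset.sum_mul_sq_le_sq_mul_sq Finset.univ a b
  simpa [dotProduct, sq] using this

lemma aux_dot_amgm (a b : Fin n → ℝ) : |a ⬝ᵥ b| ≤ (a ⬝ᵥ a + b ⬝ᵥ b) / 2 := by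
  have h1 : 0 ≤ (a - b) ⬝ᵥ (a - b) := aux_dot_self_nonneg _
  have h2 : 0 ≤ (a + b) ⬝ᵥ (a + b) := aux_dot_self_nonneg _
  simp only [sub_dotProduct, dotProduct_sub, add_dotProduct, dotProduct_add] at h1 h2
  rw [dotProduct_comm b a] at h1 h2
  rw [abs_le]; constructor <;> linarith

/-- kernel quadratic form -/
lemma aux_kform (ev : ℕ → ℝ) (hev_pos : ∀ i, 0 < ev i) (G : ℕ → Fin n → ℝ)
    (hs : ∀ j, Summable fun m => ev m * G m j ^ 2) (a b : Fin n → ℝ) :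
    HasSum (fun m => ev m * (G m ⬝ᵥ a) * (G m ⬝ᵥ b) / n)
      (a ⬝ᵥ (Matrix.of (fun i j => (∑' m, ev m * G m i * G m j) / n) *ᵥ b)) := by
  have h1 : ∀ i j, HasSum (fun m => a i * (ev m * G m i * G m j / n * b j))
      (a i * ((∑' m, ev m * G m i * G m j) / n * b j)) := fun i j =>
    ((((aux_summable_mercer ev hev_pos (fun m => G m i) (fun m => G m j) (hs i) (hs j)).hasSum.div_const _).mul_right _).mul_left _)
  have h2 := hasSum_sum (s := Finset.univ) fun i _ => hasSum_sum (s := Finset.univ) fun j _ => h1 i j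
  simp only [dotProduct, mulVec, Matrix.of_apply]
  simp only [← Finset.mul_sum] at h2
  refine h2.congr_fun fun m => ?_
  rw [mul_assoc, mul_comm (∑ i, G m i * a i), Finset.mul_sum, Finset.mul_sum, Finset.sum_div]
  refine Finset.sum_congr rfl fun i _ => ?_
  simp only [Finset.mul_sum, Finset.sum_mul, Finset.sum_div]
  refine Finset.sum_congr rfl fun j _ => ?_
  ring

lemma aux_kform_fin (ev : ℕ → ℝ) (G : ℕ → Fin n → ℝ) (D : ℕ) (a b : Fin n → ℝ) :
    ∑ m ∈ Finset.range D, ev m * (G m ⬝ᵥ a) * (G m ⬝ᵥ b) / n =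
      (a ⬝ᵥ (Matrix.of (fun i j => (∑ m ∈ Finset.range D, ev m * G m i * G m j) / n) *ᵥ b)) := by
  have h1 : ∀ m, ev m * (G m ⬝ᵥ a) * (G m ⬝ᵥ b) / n =
      ∑ i, ∑ j, a i * (ev m * G m i * G m j / n * b j) := by
    intro m
    simp only [dotProduct]
    rw [mul_assoc, mul_comm (∑ i, G m i * a i), Finset.mul_sum, Finset.mul_sum, Finset.sum_div]
    refine Finset.sum_congr rfl fun i _ => ?_
    simp only [Finset.mul_sum, Finset.sum_mul, Finset.sum_div]
    refine Finset.sum_congr rfl fun j _ => ?_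
    ring
  simp only [h1]
  rw [Finset.sum_comm]
  simp only [dotProduct, mulVec, Matrix.of_apply]
  refine Finset.sum_congr rfl fun i _ => ?_
  rw [Finset.sum_comm, Finset.mul_sum]
  refine Finset.sum_congr rfl fun j _ => ?_
  rw [Finset.sum_div, Finset.sum_mul, Finset.mul_sum]

lemma aux_inv_of_lower (A : Matrix (Fin n) (Fin n) ℝ) (lam : ℝ) (hl : 0 < lam)
    (h : ∀ v, lam * (v ⬝ᵥ v) ≤ v ⬝ᵥ (A *ᵥ v)) (g : Fin n → ℝ) : A *ᵥ (A⁻¹ *ᵥ g) = g := by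
  have hu : IsUnit A := by
    rw [← Matrix.mulVec_injective_iff_isUnit]
    intro x y hxy
    have h1 := h (x - y)
    have hxy : A *ᵥ x = A *ᵥ y := hxy
    rw [Matrix.mulVec_sub, hxy, sub_self, dotProduct_zero] at h1
    have h2 : (x - y) ⬝ᵥ (x - y) = 0 := le_antisymm (by nlinarith) (aux_dot_self_nonneg _)
    exact sub_eq_zero.mp (dotProduct_self_eq_zero.mp h2)
  rw [Matrix.mulVec_mulVec, Matrix.mul_nonsing_inv _ ((Matrix.isUnit_iff_isUnit_det _).mp hu), Matrix.one_mulVec]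

lemma aux_compare (A A' : Matrix (Fin n) (Fin n) ℝ) (lam : ℝ) (hl : 0 < lam)
    (h : ∀ v, lam * (v ⬝ᵥ v) ≤ v ⬝ᵥ (A *ᵥ v))
    (hE : ∀ a b, |a ⬝ᵥ (A *ᵥ b) - a ⬝ᵥ (A' *ᵥ b)| ≤ lam * ((a ⬝ᵥ a + b ⬝ᵥ b) / 2))
    (w w' : Fin n → ℝ) (hw : A *ᵥ w = A' *ᵥ w') : w ⬝ᵥ w ≤ 4 * (w' ⬝ᵥ w') := by
  have h1 := h (w - w')
  have h2 := (abs_le.mp (hE (w - w') w')).1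
  rw [Matrix.mulVec_sub, hw, dotProduct_sub (w - w') (A' *ᵥ w')] at h1
  have h3 : 0 ≤ (w - w' - w') ⬝ᵥ (w - w' - w') := aux_dot_self_nonneg _
  have h4 : (w - w') ⬝ᵥ (w - w') ≤ w' ⬝ᵥ w' := by
    by_contra hc
    push Not at hc
    nlinarith
  simp only [sub_dotProduct, dotProduct_sub] at h3 h4
  rw [dotProduct_comm w' w] at h3 h4
  linarith

lemma aux_w_bound (A' : Matrix (Fin n) (Fin n) ℝ) (lam : ℝ) (hl : 0 < lam)
    (h : ∀ v, lam * (v ⬝ᵥ v) ≤ v ⬝ᵥ (A' *ᵥ v)) (w g : Fin n → ℝ) (hw : A' *ᵥ w = g) :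
    lam ^ 2 * (w ⬝ᵥ w) ≤ g ⬝ᵥ g := by
  have h1 := h w
  rw [hw] at h1
  have h2 : 0 ≤ (g - lam • w) ⬝ᵥ (g - lam • w) := aux_dot_self_nonneg _
  simp only [sub_dotProduct, dotProduct_sub, smul_dotProduct, dotProduct_smul, smul_eq_mul] at h2
  rw [dotProduct_comm g w] at h2
  nlinarith

/-- the main effective-dimension computation -/
lemma aux_head (ev : ℕ → ℝ) (hev_pos : ∀ i, 0 < ev i) (G : ℕ → Fin n → ℝ) (hn : 0 < n)
    (lam : ℝ) (hl : 0 < lam) (D : ℕ)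
    (H : ∀ v : ℕ → ℝ, 1 / 4 * ∑ l ∈ Finset.range D, (ev l + lam) * ev l * v l ^ 2 ≤
      1 / n * ∑ j, (∑ l ∈ Finset.range D, ev l * v l * G l j) ^ 2 + lam * ∑ l ∈ Finset.range D, ev l * v l ^ 2)
    (w : Fin n → ℝ) (m : ℕ) (hm : m < D)
    (hw : ∀ j, (∑ l ∈ Finset.range D, ev l * (G l ⬝ᵥ w) * G l j) / n + lam * w j = G m j) :
    ev m ^ 2 / n * (w ⬝ᵥ w) ≤ 4 * ev m / (ev m + lam) ∧
      (8 * lam ≤ ev m → 1 / 4 ≤ (ev m ^ 2 / n * (w ⬝ᵥ w)) * (G m ⬝ᵥ G m / n)) := by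
  have hn0 : (0 : ℝ) < n := by exact_mod_cast hn
  have hem := hev_pos m
  let y : ℕ → ℝ := fun l => ((if l = m then 1 else 0) - ev m / n * (G l ⬝ᵥ w)) / lam
  have hmD : m ∈ Finset.range D := Finset.mem_range.mpr hm
  have hsum : ∀ j, ∑ l ∈ Finset.range D, ev l * y l * G l j = ev m * w j := by
    intro j
    have e1 : ∀ l, ev l * y l * G l j = (ev l * G l j * (if l = m then 1 else 0)) / lam
        - ev m / lam / n * (ev l * (G l ⬝ᵥ w) * G l j) := by
      intro l; simp only [y]; field_simp
    simp only [e1]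
    rw [Finset.sum_sub_distrib, ← Finset.mul_sum, ← Finset.sum_div]
    simp only [mul_ite, mul_one, mul_zero, Finset.sum_ite_eq', hmD, if_true]
    have := hw j
    field_simp
    field_simp at this
    linarith
  have hy : ∀ l, lam * y l = (if l = m then 1 else 0) - ev m / n * (G l ⬝ᵥ w) := by
    intro l; simp only [y]; field_simp
  have hww : ∑ l ∈ Finset.range D, ev l * y l * (G l ⬝ᵥ w) = ev m * (w ⬝ᵥ w) := by
    have : ∀ l, ev l * y l * (G l ⬝ᵥ w) = ∑ j, (ev l * y l * G l j) * w j := by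
      intro l; simp only [dotProduct, Finset.mul_sum]
      exact Finset.sum_congr rfl fun j _ => by ring
    simp only [this]
    rw [Finset.sum_comm]
    simp only [← Finset.sum_mul, hsum]
    simp only [dotProduct, Finset.mul_sum]
    exact Finset.sum_congr rfl fun j _ => by ring
  have hly : lam * ∑ l ∈ Finset.range D, ev l * y l ^ 2 = ev m * y m - ev m ^ 2 / n * (w ⬝ᵥ w) := by
    rw [Finset.mul_sum]
    have : ∀ l, lam * (ev l * y l ^ 2) = ev l * y l * (if l = m then 1 else 0) - ev m / n * (ev l * y l * (G l ⬝ᵥ w)) := by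
      intro l
      rw [show lam * (ev l * y l ^ 2) = ev l * y l * (lam * y l) by ring, hy]; ring
    simp only [this]
    rw [Finset.sum_sub_distrib, ← Finset.mul_sum, hww]
    simp only [mul_ite, mul_one, mul_zero, Finset.sum_ite_eq', hmD, if_true]
    ring
  have hsq : 1 / n * ∑ j, (∑ l ∈ Finset.range D, ev l * y l * G l j) ^ 2 = ev m ^ 2 / n * (w ⬝ᵥ w) := by
    simp only [hsum, dotProduct, Finset.mul_sum]
    exact Finset.sum_congr rfl fun j _ => by ring
  have hH := H y
  rw [hly, hsq] at hH
  have hge : (ev m + lam) * ev m * y m ^ 2 ≤ ∑ l ∈ Finset.range D, (ev l + lam) * ev l * y l ^ 2 :=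
    Finset.single_le_sum (f := fun l => (ev l + lam) * ev l * y l ^ 2)
      (fun l _ => by have := hev_pos l; positivity) hmD
  have hnn : 0 ≤ lam * ∑ l ∈ Finset.range D, ev l * y l ^ 2 :=
    mul_nonneg hl.le (Finset.sum_nonneg fun l _ => by have := hev_pos l; positivity)
  have hkey : (ev m + lam) * ev m * y m ^ 2 ≤ 4 * (ev m * y m) := by linarith
  have hkey2 : (ev m + lam) * y m ^ 2 ≤ 4 * y m := by
    have : ev m * ((ev m + lam) * y m ^ 2) ≤ ev m * (4 * y m) := by nlinarith
    exact le_of_mul_le_mul_left this hem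
  have hpos : 0 < ev m + lam := by linarith
  have hy0 : 0 ≤ y m := by nlinarith [mul_nonneg hpos.le (sq_nonneg (y m))]
  have hyle : (ev m + lam) * y m ≤ 4 := by
    rcases hy0.eq_or_lt with h0 | h0
    · rw [← h0]; norm_num
    · have : y m * ((ev m + lam) * y m) ≤ y m * 4 := by nlinarith
      exact le_of_mul_le_mul_left this h0
  constructor
  · rw [le_div_iff₀ hpos]
    have h1 : ev m ^ 2 / n * (w ⬝ᵥ w) ≤ ev m * y m := by linarith
    nlinarith [mul_le_mul_of_nonneg_right h1 hpos.le]
  · intro h8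
    have h1 : lam * y m ≤ 1 / 2 := by nlinarith [mul_nonneg hl.le hy0, mul_nonneg (sub_nonneg.mpr h8) hy0]
    have h2 := hy m
    simp only [if_true] at h2
    have h3 : 1 / 2 ≤ ev m / n * (G m ⬝ᵥ w) := by linarith
    have h4 := aux_dot_cs (G m) w
    have h5 : (1 / 2 : ℝ) ^ 2 ≤ (ev m / n * (G m ⬝ᵥ w)) ^ 2 := by gcongr
    calc (1 / 4 : ℝ) ≤ (ev m / n * (G m ⬝ᵥ w)) ^ 2 := by linarith
      _ = (ev m / n) ^ 2 * (G m ⬝ᵥ w) ^ 2 := by ring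
      _ ≤ (ev m / n) ^ 2 * ((G m ⬝ᵥ G m) * (w ⬝ᵥ w)) := by gcongr
      _ = _ := by field_simp
end Det


section Det2
variable {n : ℕ}

lemma aux_det (hn : 0 < n) (ev : ℕ → ℝ) (hev_pos : ∀ i, 0 < ev i) (G : ℕ → Fin n → ℝ)
    (lam : ℝ) (hl : 0 < lam) (D : ℕ) (hevD : ∀ m, ev (m + D) ≤ lam)
    (hs : ∀ j, Summable fun m => ev m * G m j ^ 2)
    (htail : ∀ j, ∑' m, ev (m + D) * G (m + D) j ^ 2 ≤ lam)
    (H : ∀ v : ℕ → ℝ, 1 / 4 * ∑ l ∈ Finset.range D, (ev l + lam) * ev l * v l ^ 2 ≤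
      1 / n * ∑ j, (∑ l ∈ Finset.range D, ev l * v l * G l j) ^ 2 + lam * ∑ l ∈ Finset.range D, ev l * v l ^ 2)
    (A : Matrix (Fin n) (Fin n) ℝ)
    (hA : A = Matrix.of (fun i j => (∑' m, ev m * G m i * G m j) / n) + lam • 1) :
    Summable (fun m => ev m ^ 2 * ((A⁻¹ *ᵥ G m) ⬝ᵥ (A⁻¹ *ᵥ G m))) ∧
    1 / n * ∑' m, ev m ^ 2 * ((A⁻¹ *ᵥ G m) ⬝ᵥ (A⁻¹ *ᵥ G m)) ≤
      4 * (∑ m ∈ Finset.range D, 4 * ev m / (ev m + lam) + 1) ∧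
    ∀ m < D, 8 * lam ≤ ev m →
      1 / 4 ≤ 4 * (ev m ^ 2 / n * ((A⁻¹ *ᵥ G m) ⬝ᵥ (A⁻¹ *ᵥ G m))) * (G m ⬝ᵥ G m / n) := by
  have hn0 : (0 : ℝ) < n := by exact_mod_cast hn
  set A' : Matrix (Fin n) (Fin n) ℝ :=
    Matrix.of (fun i j => (∑ m ∈ Finset.range D, ev m * G m i * G m j) / n) + lam • 1 with hA'
  have fA : ∀ a b, a ⬝ᵥ (A *ᵥ b) = ∑' m, ev m * (G m ⬝ᵥ a) * (G m ⬝ᵥ b) / n + lam * (a ⬝ᵥ b) := by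
    intro a b
    rw [hA, Matrix.add_mulVec, dotProduct_add, (aux_kform ev hev_pos G hs a b).tsum_eq, Matrix.smul_mulVec,
      Matrix.one_mulVec, dotProduct_smul, smul_eq_mul]
  have fA' : ∀ a b, a ⬝ᵥ (A' *ᵥ b) = ∑ m ∈ Finset.range D, ev m * (G m ⬝ᵥ a) * (G m ⬝ᵥ b) / n + lam * (a ⬝ᵥ b) := by
    intro a b
    rw [hA', Matrix.add_mulVec, dotProduct_add, aux_kform_fin ev G D a b, Matrix.smul_mulVec,
      Matrix.one_mulVec, dotProduct_smul, smul_eq_mul]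
  have hq : ∀ m v, 0 ≤ ev m * (G m ⬝ᵥ v) * (G m ⬝ᵥ v) / n := by
    intro m v
    rw [mul_assoc]
    exact div_nonneg (mul_nonneg (hev_pos m).le (mul_self_nonneg _)) hn0.le
  have lA : ∀ v, lam * (v ⬝ᵥ v) ≤ v ⬝ᵥ (A *ᵥ v) := by
    intro v; rw [fA]
    have : 0 ≤ ∑' m, ev m * (G m ⬝ᵥ v) * (G m ⬝ᵥ v) / n := tsum_nonneg fun m => hq m v
    linarith
  have lA' : ∀ v, lam * (v ⬝ᵥ v) ≤ v ⬝ᵥ (A' *ᵥ v) := by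
    intro v; rw [fA']; linarith [Finset.sum_nonneg fun m (_ : m ∈ Finset.range D) => hq m v]
  -- the tail
  have hsj : ∀ j, Summable fun m => ev (m + D) * G (m + D) j ^ 2 := fun j =>
    (summable_nat_add_iff D).mpr (hs j)
  have hT : HasSum (fun m => ev (m + D) * (G (m + D) ⬝ᵥ G (m + D)) / n)
      ((∑ j, ∑' m, ev (m + D) * G (m + D) j ^ 2) / n) := by
    refine HasSum.congr_fun ((hasSum_sum (s := Finset.univ) fun j _ => (hsj j).hasSum).div_const (n : ℝ)) fun m => ?_
    simp only [dotProduct, Finset.mul_sum, sq]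
  have hTle : (∑ j, ∑' m, ev (m + D) * G (m + D) j ^ 2) / n ≤ lam := by
    rw [div_le_iff₀ hn0]
    refine (Finset.sum_le_sum fun j _ => htail j).trans ?_
    simp [mul_comm]
  have hE : ∀ a b, |a ⬝ᵥ (A *ᵥ b) - a ⬝ᵥ (A' *ᵥ b)| ≤ lam * ((a ⬝ᵥ a + b ⬝ᵥ b) / 2) := by
    intro a b
    have hsum := (aux_kform ev hev_pos G hs a b).summable
    have e1 := hsum.sum_add_tsum_nat_add D
    rw [fA, fA', ← e1, show ∀ x y z : ℝ, x + y + z - (x + z) = y from fun x y z => by ring]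
    have hb : ∀ m, ‖ev (m + D) * (G (m + D) ⬝ᵥ a) * (G (m + D) ⬝ᵥ b) / n‖ ≤
        ev (m + D) * (G (m + D) ⬝ᵥ G (m + D)) / n * ((a ⬝ᵥ a + b ⬝ᵥ b) / 2) := by
      intro m
      have h1 := aux_dot_cs (G (m + D)) a
      have h2 := aux_dot_cs (G (m + D)) b
      rw [norm_div, norm_mul, norm_mul, Real.norm_eq_abs, Real.norm_eq_abs, Real.norm_eq_abs, Real.norm_eq_abs,
        abs_of_pos (hev_pos _), abs_of_pos hn0, div_mul_eq_mul_div, mul_assoc, mul_assoc]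
      refine div_le_div_of_nonneg_right (mul_le_mul_of_nonneg_left ?_ (hev_pos _).le) hn0.le
      nlinarith [sq_nonneg (|G (m + D) ⬝ᵥ a| - |G (m + D) ⬝ᵥ b|), sq_abs (G (m + D) ⬝ᵥ a), sq_abs (G (m + D) ⬝ᵥ b)]
    have := tsum_of_norm_bounded (hT.mul_right ((a ⬝ᵥ a + b ⬝ᵥ b) / 2)) hb
    rw [Real.norm_eq_abs] at this
    refine this.trans (mul_le_mul_of_nonneg_right hTle ?_)
    have := aux_dot_self_nonneg a
    have := aux_dot_self_nonneg b
    positivity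
  have hE' : ∀ a b, |a ⬝ᵥ (A' *ᵥ b) - a ⬝ᵥ (A *ᵥ b)| ≤ lam * ((a ⬝ᵥ a + b ⬝ᵥ b) / 2) := by
    intro a b; rw [abs_sub_comm]; exact hE a b
  have hAw : ∀ m, A *ᵥ (A⁻¹ *ᵥ G m) = G m := fun m => aux_inv_of_lower A lam hl lA (G m)
  have hAw' : ∀ m, A' *ᵥ (A'⁻¹ *ᵥ G m) = G m := fun m => aux_inv_of_lower A' lam hl lA' (G m)
  have c1 : ∀ m, (A⁻¹ *ᵥ G m) ⬝ᵥ (A⁻¹ *ᵥ G m) ≤ 4 * ((A'⁻¹ *ᵥ G m) ⬝ᵥ (A'⁻¹ *ᵥ G m)) := fun m =>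
    aux_compare A A' lam hl lA hE _ _ (by rw [hAw, hAw'])
  have c2 : ∀ m, (A'⁻¹ *ᵥ G m) ⬝ᵥ (A'⁻¹ *ᵥ G m) ≤ 4 * ((A⁻¹ *ᵥ G m) ⬝ᵥ (A⁻¹ *ᵥ G m)) := fun m =>
    aux_compare A' A lam hl lA' hE' _ _ (by rw [hAw, hAw'])
  have hhead : ∀ m < D, _ := fun m hm => aux_head ev hev_pos G hn lam hl D H (A'⁻¹ *ᵥ G m) m hm (by
    intro j
    have h1 := fA' (Pi.single j 1) (A'⁻¹ *ᵥ G m)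
    rw [hAw'] at h1
    simp only [single_dotProduct, dotProduct_single, one_mul, mul_one] at h1
    rw [h1, Finset.sum_div]
    congr 1
    exact Finset.sum_congr rfl fun l _ => by ring)
  have htl : ∀ m, ev (m + D) ^ 2 * ((A⁻¹ *ᵥ G (m + D)) ⬝ᵥ (A⁻¹ *ᵥ G (m + D))) ≤
      ev (m + D) * (G (m + D) ⬝ᵥ G (m + D)) / n * (4 * n / lam) := by
    intro m
    have h1 := aux_w_bound A' lam hl lA' _ _ (hAw' (m + D))
    have h2 := c1 (m + D)
    set W := (A⁻¹ *ᵥ G (m + D)) ⬝ᵥ (A⁻¹ *ᵥ G (m + D))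
    set W' := (A'⁻¹ *ᵥ G (m + D)) ⬝ᵥ (A'⁻¹ *ᵥ G (m + D)) with hW'
    set g := (G (m + D) ⬝ᵥ G (m + D))
    have hW0 : 0 ≤ W' := aux_dot_self_nonneg _
    have he := hev_pos (m + D)
    have he2 := hevD m
    calc ev (m + D) ^ 2 * W ≤ ev (m + D) ^ 2 * (4 * W') := by gcongr
      _ = ev (m + D) * (4 / lam) * ((ev (m + D) * lam) * W') := by field_simp
      _ ≤ ev (m + D) * (4 / lam) * ((lam * lam) * W') := by gcongr
      _ ≤ ev (m + D) * (4 / lam) * g := by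
        refine mul_le_mul_of_nonneg_left ?_ (by positivity)
        nlinarith
      _ = _ := by field_simp
  have hWnn : ∀ m, 0 ≤ ev m ^ 2 * ((A⁻¹ *ᵥ G m) ⬝ᵥ (A⁻¹ *ᵥ G m)) := fun m =>
    mul_nonneg (sq_nonneg _) (aux_dot_self_nonneg _)
  have hsT : Summable (fun m => ev (m + D) ^ 2 * ((A⁻¹ *ᵥ G (m + D)) ⬝ᵥ (A⁻¹ *ᵥ G (m + D)))) :=
    Summable.of_nonneg_of_le (fun m => hWnn _) htl (hT.mul_right _).summable
  have hS := (summable_nat_add_iff D (f := fun m => ev m ^ 2 * ((A⁻¹ *ᵥ G m) ⬝ᵥ (A⁻¹ *ᵥ G m)))).mp hsT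
  refine ⟨hS, ?_, ?_⟩
  · rw [← hS.sum_add_tsum_nat_add D, mul_add, mul_add]
    refine add_le_add ?_ ?_
    · rw [Finset.mul_sum, Finset.mul_sum]
      refine Finset.sum_le_sum fun m hm => ?_
      have h1 := (hhead m (Finset.mem_range.mp hm)).1
      have h2 := c1 m
      calc _ ≤ 1 / (n : ℝ) * (ev m ^ 2 * (4 * ((A'⁻¹ *ᵥ G m) ⬝ᵥ (A'⁻¹ *ᵥ G m)))) := by gcongr
        _ = 4 * (ev m ^ 2 / n * ((A'⁻¹ *ᵥ G m) ⬝ᵥ (A'⁻¹ *ᵥ G m))) := by ring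
        _ ≤ _ := by gcongr
    · have h1 := hsT.tsum_le_tsum htl (hT.mul_right _).summable
      rw [(hT.mul_right (4 * n / lam)).tsum_eq] at h1
      have h2 : (∑ j, ∑' m, ev (m + D) * G (m + D) j ^ 2) / n * (4 * n / lam) ≤ lam * (4 * n / lam) := by gcongr
      calc _ ≤ 1 / (n : ℝ) * (lam * (4 * n / lam)) := by
            refine mul_le_mul_of_nonneg_left (h1.trans h2) (by positivity)
        _ = _ := by field_simp
  · intro m hm h8
    refine ((hhead m hm).2 h8).trans ?_
    refine mul_le_mul_of_nonneg_right ?_ (div_nonneg (aux_dot_self_nonneg _) hn0.le)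
    have h2 := c2 m
    calc _ ≤ ev m ^ 2 / n * (4 * ((A⁻¹ *ᵥ G m) ⬝ᵥ (A⁻¹ *ᵥ G m))) := by gcongr
      _ = _ := by ring

/-- lower bound consequence -/
lemma aux_det_lower (ev W g : ℕ → ℝ) (hW : ∀ m, 0 ≤ W m) (hg : ∀ m, 0 ≤ g m) (hn : 0 < n)
    (hS : Summable fun m => ev m ^ 2 * W m) (m₀ : ℕ)
    (h : ∀ m < m₀, 1 / 4 ≤ 4 * (ev m ^ 2 / n * W m) * (g m / n))
    (hsum : ∑ m ∈ Finset.range m₀, g m ≤ 2 * m₀ * n) :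
    (m₀ : ℝ) / 32 ≤ 1 / n * ∑' m, ev m ^ 2 * W m := by
  have hn0 : (0 : ℝ) < n := by exact_mod_cast hn
  have h1 : ∑ m ∈ Finset.range m₀, ev m ^ 2 * W m ≤ ∑' m, ev m ^ 2 * W m :=
    hS.sum_le_tsum _ fun m _ => mul_nonneg (sq_nonneg _) (hW m)
  have h2 : ∀ m ∈ Finset.range m₀, 1 / 4 - g m / n / 16 ≤ 4 * (ev m ^ 2 / n * W m) := by
    intro m hm
    have h3 := h m (Finset.mem_range.mp hm)
    have ha : 0 ≤ g m / n := div_nonneg (hg m) hn0.le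
    have hb : 0 ≤ 4 * (ev m ^ 2 / n * W m) := by have := hW m; positivity
    set a := g m / n
    set b := 4 * (ev m ^ 2 / n * W m)
    nlinarith [sq_nonneg (a / 16 - b)]
  have h3 := Finset.sum_le_sum h2
  rw [Finset.sum_sub_distrib, ← Finset.sum_div, ← Finset.sum_div, ← Finset.sum_div] at h3
  simp only [Finset.sum_const, Finset.card_range, nsmul_eq_mul] at h3
  have h4 : (∑ m ∈ Finset.range m₀, g m) / n ≤ 2 * m₀ := by rw [div_le_iff₀ hn0]; exact hsum
  have h5 : ∑ m ∈ Finset.range m₀, 4 * (ev m ^ 2 / n * W m) = 4 * (1 / n * ∑ m ∈ Finset.range m₀, ev m ^ 2 * W m) := by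
    rw [Finset.mul_sum, Finset.mul_sum]
    exact Finset.sum_congr rfl fun m _ => by ring
  have h6 : 1 / (n : ℝ) * ∑ m ∈ Finset.range m₀, ev m ^ 2 * W m ≤ 1 / n * ∑' m, ev m ^ 2 * W m := by gcongr
  rw [h5] at h3
  linarith
end Det2

section V
variable {𝓧 : Type*} [MeasurableSpace 𝓧]
lemma aux_V (μ : Measure 𝓧) (k : 𝓧 → 𝓧 → ℝ) (hk_symm : ∀ x y, k x y = k y x)
    (ev : ℕ → ℝ) (ef : ℕ → 𝓧 → ℝ) (σ2 : ℝ) (n : ℕ) (x : Fin n → 𝓧) (lam : ℝ)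
    (hkk : ∀ i j, Integrable (fun t => k t (x i) * k t (x j)) μ ∧
      HasSum (fun m => ev m ^ 2 * ef m (x i) * ef m (x j)) (∫ t, k t (x i) * k t (x j) ∂μ))
    (A : Matrix (Fin n) (Fin n) ℝ)
    (hA : A = (Matrix.of fun i j => k (x i) (x j) / n) + lam • (1 : Matrix (Fin n) (Fin n) ℝ)) :
    varianceTerm10 μ k σ2 n x lam = σ2 / n * (1 / n * ∑' m, ev m ^ 2 *
      ((A⁻¹ *ᵥ fun j => ef m (x j)) ⬝ᵥ (A⁻¹ *ᵥ fun j => ef m (x j)))) := by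
  have hAT : Aᵀ = A := by
    rw [hA, Matrix.transpose_add, Matrix.transpose_smul, Matrix.transpose_one]
    congr 1
    ext i j
    simp [hk_symm (x j) (x i)]
  have hBT : (A⁻¹)ᵀ = A⁻¹ := by rw [Matrix.transpose_nonsing_inv, hAT]
  have hq : ∀ g : Fin n → ℝ, g ⬝ᵥ ((A⁻¹ ^ 2) *ᵥ g) = (A⁻¹ *ᵥ g) ⬝ᵥ (A⁻¹ *ᵥ g) := by
    intro g
    rw [sq, ← Matrix.mulVec_mulVec, Matrix.dotProduct_mulVec, ← Matrix.mulVec_transpose, hBT]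
  have hexp : ∀ g : Fin n → ℝ, g ⬝ᵥ ((A⁻¹ ^ 2) *ᵥ g) = ∑ i, ∑ j, (A⁻¹ ^ 2) i j * (g i * g j) := by
    intro g
    simp only [dotProduct, mulVec, Finset.mul_sum]
    exact Finset.sum_congr rfl fun i _ => Finset.sum_congr rfl fun j _ => by ring
  have hI : ∫ t, (fun i => k t (x i)) ⬝ᵥ ((A⁻¹ ^ 2) *ᵥ fun i => k t (x i)) ∂μ =
      ∑ i, ∑ j, (A⁻¹ ^ 2) i j * ∫ t, k t (x i) * k t (x j) ∂μ := by
    simp only [hexp]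
    have hIntg : ∀ i j, Integrable (fun t => (A⁻¹ ^ 2) i j * (k t (x i) * k t (x j))) μ := fun i j =>
      (hkk i j).1.const_mul _
    have h1 := integral_finsetSum (μ := μ) Finset.univ
      (f := fun i t => ∑ j, (A⁻¹ ^ 2) i j * (k t (x i) * k t (x j)))
      fun i _ => integrable_finsetSum _ fun j _ => hIntg i j
    refine h1.trans ?_
    refine Finset.sum_congr rfl fun i _ => ?_
    refine (integral_finsetSum (μ := μ) Finset.univ
      (f := fun j t => (A⁻¹ ^ 2) i j * (k t (x i) * k t (x j))) fun j _ => hIntg i j).trans ?_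
    refine Finset.sum_congr rfl fun j _ => ?_
    rw [integral_const_mul]
  have hS : HasSum (fun m => ev m ^ 2 * ((A⁻¹ *ᵥ fun j => ef m (x j)) ⬝ᵥ (A⁻¹ *ᵥ fun j => ef m (x j))))
      (∑ i, ∑ j, (A⁻¹ ^ 2) i j * ∫ t, k t (x i) * k t (x j) ∂μ) := by
    refine (hasSum_sum (s := Finset.univ) fun i _ => hasSum_sum (s := Finset.univ) fun j _ =>
      (hkk i j).2.mul_left ((A⁻¹ ^ 2) i j)).congr_fun fun m => ?_
    rw [← hq, hexp, Finset.mul_sum]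
    refine Finset.sum_congr rfl fun i _ => ?_
    rw [Finset.mul_sum]
    exact Finset.sum_congr rfl fun j _ => by ring
  unfold varianceTerm10
  rw [← hA, hI, hS.tsum_eq]
  by_cases hn : (n : ℝ) = 0
  · simp [hn]
  · field_simp
end V


section Prob
variable {𝓧 Ω : Type*} [MeasurableSpace 𝓧] [MeasurableSpace Ω]

lemma aux_ratio_le (e lam α : ℝ) (he : 0 < e) (hl : 0 < lam) (hα0 : 0 < α) (hα1 : α ≤ 1) :
    e / (e + lam) ≤ e ^ α * lam ^ (-α) := by
  rw [Real.rpow_neg hl.le, ← div_eq_mul_inv, ← Real.div_rpow he.le hl.le]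
  rcases le_total e lam with h | h
  · have h1 : e / lam ≤ 1 := (div_le_one hl).mpr h
    calc e / (e + lam) ≤ e / lam := by gcongr; linarith
      _ = (e / lam) ^ (1 : ℝ) := (Real.rpow_one _).symm
      _ ≤ (e / lam) ^ α := Real.rpow_le_rpow_of_exponent_ge (by positivity) h1 hα1
  · have h1 : 1 ≤ e / lam := (one_le_div hl).mpr h
    calc e / (e + lam) ≤ 1 := by rw [div_le_one (by positivity)]; linarith
      _ ≤ _ := Real.one_le_rpow h1 hα0.le

lemma aux_prob1 (P : Measure Ω) [IsProbabilityMeasure P] (μ : Measure 𝓧) [IsProbabilityMeasure μ]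
    (X : ℕ → Ω → 𝓧) (hX_meas : ∀ i, Measurable (X i)) (hX_indep : iIndepFun X P)
    (hX_id : ∀ i, P.map (X i) = μ)
    (ev : ℕ → ℝ) (ef : ℕ → 𝓧 → ℝ) (hev_pos : ∀ i, 0 < ev i)
    (horth : ∀ i j, ∫ t, ef i t * ef j t ∂μ = if i = j then (1 : ℝ) else 0)
    (hm : ∀ i j, AEMeasurable (fun t => ef i t * ef j t) μ)
    (lam α M : ℝ) (hl : 0 < lam) (hα0 : 0 < α) (hα1 : α ≤ 1)
    (hM : ∀ᵐ x ∂μ, ∀ D, ∑ l ∈ Finset.range D, ev l ^ α * ef l x ^ 2 ≤ M ^ 2)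
    (n : ℕ) (hn : 0 < n) (D : ℕ) :
    P {ω | ¬ ∀ v : ℕ → ℝ, 1 / 4 * ∑ l ∈ Finset.range D, (ev l + lam) * ev l * v l ^ 2 ≤
      1 / n * ∑ j : Fin n, (∑ l ∈ Finset.range D, ev l * v l * ef l (X j ω)) ^ 2 +
        lam * ∑ l ∈ Finset.range D, ev l * v l ^ 2} ≤
      ENNReal.ofReal (D * Real.exp (-(n / (4 * (M ^ 2 * lam ^ (-α) + 1))))) := by
  classical
  have hn0 : (0 : ℝ) < n := by exact_mod_cast hn
  let s : Fin D → ℝ := fun a => Real.sqrt (ev a / (ev a + lam))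
  have hs2 : ∀ a, s a * s a = ev a / (ev a + lam) := fun a =>
    Real.mul_self_sqrt (by have := hev_pos a; positivity)
  let F : 𝓧 → Fin D → Fin D → ℝ := fun x a b =>
    s a * s b * (ef a x * ef b x) + if a = b then lam / (ev a + lam) else 0
  have hquad : ∀ x v, v ⬝ᵥ (Matrix.of (F x) *ᵥ v) =
      (∑ a, s a * ef a x * v a) ^ 2 + ∑ a : Fin D, lam / (ev a + lam) * v a ^ 2 := by
    intro x v
    simp only [dotProduct, mulVec, Matrix.of_apply, F, add_mul, ite_mul, zero_mul, Finset.sum_add_distrib,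
      Finset.sum_ite_eq, Finset.mem_univ, if_true, mul_add]
    congr 1
    · rw [sq, Finset.sum_mul_sum]
      refine Finset.sum_congr rfl fun a _ => ?_
      rw [Finset.mul_sum]
      exact Finset.sum_congr rfl fun b _ => by ring
    · exact Finset.sum_congr rfl fun a _ => by ring
  have hIntg := aux_prod_integrable μ ef horth hm
  have hR : 0 < M ^ 2 * lam ^ (-α) + 1 := by
    have : 0 < lam ^ (-α) := Real.rpow_pos_of_pos hl _
    positivity
  have hFi : ∀ a b, Integrable (fun x => F x a b) μ := fun a b =>
    ((hIntg a b).const_mul _).add (integrable_const _)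
  have key := aux_chernoff2 P μ X hX_meas hX_indep hX_id F (fun a b => (hFi a b).aemeasurable)
    (M ^ 2 * lam ^ (-α) + 1) hR ?_ hFi ?_ n
  · rw [Fintype.card_fin] at key
    refine le_trans (measure_mono ?_) key
    intro ω hω
    rw [Set.mem_ofPred_eq] at hω ⊢
    by_contra hcon
    push Not at hcon
    apply hω
    intro y
    have h1 := hcon fun a => Real.sqrt ((ev a + lam) * ev a) * y a
    rw [Matrix.sum_mulVec, dotProduct_sum] at h1
    simp only [hquad] at h1
    have e1 : ∀ a : Fin D, ∀ x, s a * ef a x * (Real.sqrt ((ev a + lam) * ev a) * y a) = ev a * y a * ef a x := by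
      intro a x
      have hp := hev_pos a
      have : s a * Real.sqrt ((ev a + lam) * ev a) = ev a := by
        simp only [s]
        rw [← Real.sqrt_mul (by positivity), show ev a / (ev a + lam) * ((ev a + lam) * ev a) = ev a ^ 2 by field_simp,
          Real.sqrt_sq hp.le]
      calc _ = (s a * Real.sqrt ((ev a + lam) * ev a)) * y a * ef a x := by ring
        _ = _ := by rw [this]
    have e2 : ∀ a : Fin D, (Real.sqrt ((ev a + lam) * ev a) * y a) ^ 2 = (ev a + lam) * ev a * y a ^ 2 := by
      intro a
      have hp := hev_pos a
      rw [mul_pow, Real.sq_sqrt (by positivity)]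
    have e3 : ∀ a : Fin D, lam / (ev a + lam) * (Real.sqrt ((ev a + lam) * ev a) * y a) ^ 2 = lam * (ev a * y a ^ 2) := by
      intro a
      have hp := hev_pos a
      rw [e2]; field_simp
    simp only [e1, e3] at h1
    have e4 : (fun a : Fin D => Real.sqrt ((ev a + lam) * ev a) * y a) ⬝ᵥ (fun a : Fin D => Real.sqrt ((ev a + lam) * ev a) * y a)
        = ∑ l ∈ Finset.range D, (ev l + lam) * ev l * y l ^ 2 := by
      rw [Finset.sum_range]
      simp only [dotProduct, ← sq, e2]
    rw [e4, Finset.sum_add_distrib] at h1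
    simp only [Finset.sum_const, Finset.card_range, nsmul_eq_mul] at h1
    rw [← Finset.mul_sum, ← Finset.sum_range (fun l => ev l * y l ^ 2)] at h1
    have e5 : ∀ x, ∑ a : Fin D, ev a * y a * ef a x = ∑ l ∈ Finset.range D, ev l * y l * ef l x := fun x =>
      (Finset.sum_range (fun l => ev l * y l * ef l x)).symm
    simp only [e5] at h1
    rw [Finset.sum_range (fun j => (∑ l ∈ Finset.range D, ev l * y l * ef l (X j ω)) ^ 2)] at h1
    have h2 := mul_le_mul_of_nonneg_left h1 (by positivity : (0 : ℝ) ≤ 1 / n)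
    calc _ = 1 / (n : ℝ) * (n / 4 * ∑ l ∈ Finset.range D, (ev l + lam) * ev l * y l ^ 2) := by field_simp
      _ ≤ _ := h2
      _ = _ := by
        rw [mul_add, ← mul_assoc (1 / (n : ℝ)) (n : ℝ), one_div_mul_cancel hn0.ne', one_mul]
  · filter_upwards [hM] with x hx
    refine ⟨?_, ?_, ?_⟩
    · ext a b
      simp only [Matrix.transpose_apply, Matrix.of_apply, F]
      by_cases hab : a = b
      · subst hab; rfl
      · rw [if_neg hab, if_neg (Ne.symm hab)]; ring
    · intro v
      rw [hquad]
      refine add_nonneg (sq_nonneg _) (Finset.sum_nonneg fun a _ => ?_)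
      have := hev_pos a
      positivity
    · intro v
      rw [hquad, add_mul, one_mul]
      have hvv : v ⬝ᵥ v = ∑ a, v a ^ 2 := by simp [dotProduct, sq]
      refine add_le_add ?_ ?_
      · rw [hvv]
        refine (Finset.sum_mul_sq_le_sq_mul_sq _ _ _).trans ?_
        refine mul_le_mul_of_nonneg_right ?_ (Finset.sum_nonneg fun a _ => sq_nonneg _)
        have hl2 : 0 < lam ^ (-α) := Real.rpow_pos_of_pos hl _
        calc ∑ a : Fin D, (s a * ef a x) ^ 2 ≤ ∑ a : Fin D, ev a ^ α * ef a x ^ 2 * lam ^ (-α) := by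
              refine Finset.sum_le_sum fun a _ => ?_
              rw [mul_pow, sq (s a), hs2]
              have := mul_le_mul_of_nonneg_right (aux_ratio_le (ev a) lam α (hev_pos a) hl hα0 hα1) (sq_nonneg (ef a x))
              linarith
          _ = (∑ l ∈ Finset.range D, ev l ^ α * ef l x ^ 2) * lam ^ (-α) := by
              rw [← Finset.sum_mul, Finset.sum_range]
          _ ≤ _ := by gcongr; exact hx D
      · rw [hvv]
        refine Finset.sum_le_sum fun a _ => ?_
        have := hev_pos a
        refine mul_le_of_le_one_left (sq_nonneg _) ?_
        rw [div_le_one (by positivity)]; linarith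
  · intro a b
    simp only [F]
    rw [integral_add ((hIntg a b).const_mul _) (integrable_const _), integral_const_mul, horth]
    have := hev_pos a
    by_cases hab : a = b
    · subst hab
      simp [hs2]
      field_simp
    · have : (a : ℕ) ≠ b := fun h => hab (Fin.ext h)
      simp [hab, this]

lemma aux_prob2 (P : Measure Ω) [IsProbabilityMeasure P] (μ : Measure 𝓧) [IsProbabilityMeasure μ]
    (X : ℕ → Ω → 𝓧) (hX_meas : ∀ i, Measurable (X i)) (hX_indep : iIndepFun X P)
    (hX_id : ∀ i, P.map (X i) = μ) (ef : ℕ → 𝓧 → ℝ)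
    (horth : ∀ i j, ∫ t, ef i t * ef j t ∂μ = if i = j then (1 : ℝ) else 0)
    (R : ℝ) (m₀ : ℕ) (hm₀ : 0 < m₀)
    (hM : ∀ᵐ x ∂μ, ∑ l ∈ Finset.range m₀, ef l x ^ 2 ≤ R)
    (n : ℕ) (hn : 0 < n) :
    P {ω | ¬ ∑ m ∈ Finset.range m₀, ∑ j : Fin n, ef m (X j ω) ^ 2 ≤ 2 * m₀ * n} ≤
      ENNReal.ofReal (R / (n * m₀)) := by
  have hn0 : (0 : ℝ) < n := by exact_mod_cast hn
  have hm0 : (0 : ℝ) < m₀ := by exact_mod_cast hm₀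
  set Z : 𝓧 → ℝ := fun x => ∑ l ∈ Finset.range m₀, ef l x ^ 2 with hZ
  have hZ0 : ∀ x, 0 ≤ Z x := fun x => Finset.sum_nonneg fun l _ => sq_nonneg _
  have hZi : Integrable Z μ := integrable_finsetSum _ fun l _ => aux_sq_integrable μ ef horth l
  have hZint : ∫ x, Z x ∂μ = m₀ := by
    have h1 := integral_finsetSum (μ := μ) (Finset.range m₀) (f := fun l x => ef l x ^ 2)
      fun l _ => aux_sq_integrable μ ef horth l
    refine h1.trans ?_
    have : ∀ l, ∫ x, ef l x ^ 2 ∂μ = 1 := by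
      intro l
      have := horth l l
      simp only [if_true] at this
      simp only [sq, this]
    simp [this]
  have hZm : ∀ j, AEStronglyMeasurable Z (P.map (X j)) := fun j => by rw [hX_id]; exact hZi.aestronglyMeasurable
  have hZXm : ∀ j, AEStronglyMeasurable (Z ∘ X j) P := fun j => (hZm j).comp_aemeasurable (hX_meas j).aemeasurable
  have hb : ∀ j, ∀ᵐ ω ∂P, Z (X j ω) ≤ R := fun j =>
    ae_of_ae_map (hX_meas j).aemeasurable (by rw [hX_id j]; exact hM)
  have hLp : ∀ j, MemLp (Z ∘ X j) 2 P := fun j => MemLp.of_bound (hZXm j) R (by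
    filter_upwards [hb j] with ω hω
    rw [Real.norm_eq_abs, Function.comp, abs_of_nonneg (hZ0 _)]; exact hω)
  have hE : ∀ j, ∫ ω, Z (X j ω) ∂P = m₀ := by
    intro j
    rw [← integral_map (hX_meas j).aemeasurable (hZm j), hX_id, hZint]
  have hIntg : ∀ j, Integrable (Z ∘ X j) P := fun j => (hLp j).integrable (by norm_num)
  have hvar : ∀ j, Var[Z ∘ X j; P] ≤ R * m₀ := by
    intro j
    refine (variance_le_expectation_sq (hZXm j)).trans ?_
    rw [← hE j, ← integral_const_mul]
    refine integral_mono_ae (hLp j).integrable_sq ((hIntg j).const_mul R) ?_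
    filter_upwards [hb j] with ω hω
    simp only [Pi.pow_apply, Function.comp]
    have := hZ0 (X j ω)
    nlinarith
  have hind : iIndepFun (fun j => Z ∘ X j) P := hX_indep.comp₀ (fun _ => Z)
    (fun j => (hX_meas j).aemeasurable) fun j => (hZm j).aemeasurable
  have hvs := IndepFun.variance_sum (s := Finset.range n) (fun j _ => hLp j)
    (fun i _ j _ hij => hind.indepFun hij)
  have hSLp : MemLp (∑ j ∈ Finset.range n, Z ∘ X j) 2 P := memLp_finsetSum' _ fun j _ => hLp j
  have hc : (0 : ℝ) < n * m₀ := by positivity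
  have cheb := meas_ge_le_variance_div_sq hSLp hc
  have hES : ∫ ω, (∑ j ∈ Finset.range n, Z ∘ X j) ω ∂P = n * m₀ := by
    simp only [Finset.sum_apply]
    have h1 := integral_finsetSum (μ := P) (Finset.range n) (f := fun j ω => (Z ∘ X j) ω)
      fun j _ => hIntg j
    refine h1.trans ?_
    simp [hE]
  rw [hES, hvs] at cheb
  refine (measure_mono ?_).trans (cheb.trans (ENNReal.ofReal_le_ofReal ?_))
  · intro ω hω
    simp only [Set.mem_ofPred_eq, not_le] at hω ⊢
    rw [Finset.sum_comm] at hω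
    simp only [Finset.sum_apply, Function.comp]
    rw [Finset.sum_range]
    refine le_trans ?_ (le_abs_self _)
    have : ∑ i : Fin n, Z (X i ω) = ∑ j : Fin n, ∑ m ∈ Finset.range m₀, ef m (X j ω) ^ 2 := rfl
    linarith
  · rw [div_le_div_iff₀ (by positivity) hc]
    have : ∑ j ∈ Finset.range n, Var[Z ∘ X j; P] ≤ n * (R * m₀) := by
      refine (Finset.sum_le_sum fun j _ => hvar j).trans ?_
      simp
    nlinarith
end Prob


section Fixed
variable {𝓧 Ω : Type*} [MeasurableSpace 𝓧] [MeasurableSpace Ω]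

lemma aux_fixed (P : Measure Ω) [IsProbabilityMeasure P] (μ : Measure 𝓧) [IsProbabilityMeasure μ]
    (X : ℕ → Ω → 𝓧) (hX_meas : ∀ i, Measurable (X i)) (hX_indep : iIndepFun X P)
    (hX_id : ∀ i, P.map (X i) = μ)
    (k : 𝓧 → 𝓧 → ℝ) (hk_symm : ∀ x y, k x y = k y x) (B : ℝ) (hB : ∀ x y, |k x y| ≤ B)
    (ev : ℕ → ℝ) (ef : ℕ → 𝓧 → ℝ) (hev_pos : ∀ i, 0 < ev i) (hev_sum : Summable ev)
    (hev_mono : ∀ i j, i ≤ j → ev j ≤ ev i)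
    (horth : ∀ i j, ∫ t, ef i t * ef j t ∂μ = if i = j then (1 : ℝ) else 0)
    (hmercer : ∀ x y, k x y = ∑' i, ev i * ef i x * ef i y)
    (heig : ∀ i x, ∫ y, k x y * ef i y ∂μ = ev i * ef i x)
    (hgood : ∀ᵐ x ∂μ, Summable fun i => ev i * ef i x ^ 2)
    (hm : ∀ i j, AEMeasurable (fun t => ef i t * ef j t) μ)
    (α M : ℝ) (hα0 : 0 < α) (hα1 : α ≤ 1)
    (hgoodα : ∀ᵐ x ∂μ, Summable fun i => ev i ^ α * ef i x ^ 2)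
    (hM : ∀ᵐ x ∂μ, ∑' i, ev i ^ α * ef i x ^ 2 ≤ M ^ 2) (σ2 : ℝ) (hσ2 : 0 < σ2)
    (n : ℕ) (hn : 0 < n) (lam : ℝ) (hl : 0 < lam) (D : ℕ) (hevD : ev D ≤ lam)
    (hD2 : M ^ 2 * ev D ^ (1 - α) ≤ lam) (m₀ : ℕ) (hm₀ : 0 < m₀) (hm₀2 : ∀ m < m₀, 8 * lam ≤ ev m) :
    P {ω | ¬ (σ2 / n * (m₀ / 32) ≤ varianceTerm10 μ k σ2 n (fun i : Fin n => X i ω) lam ∧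
        varianceTerm10 μ k σ2 n (fun i : Fin n => X i ω) lam ≤
          σ2 / n * (4 * (∑ m ∈ Finset.range D, 4 * ev m / (ev m + lam) + 1)))} ≤
      ENNReal.ofReal (D * Real.exp (-(n / (4 * (M ^ 2 * lam ^ (-α) + 1))))) +
      ENNReal.ofReal (M ^ 2 * (8 * lam) ^ (-α) / (n * m₀)) := by
  have hn0 : (0 : ℝ) < n := by exact_mod_cast hn
  have hnnα : ∀ i x, 0 ≤ ev i ^ α * ef i x ^ 2 := fun i x =>
    mul_nonneg (Real.rpow_nonneg (hev_pos i).le _) (sq_nonneg _)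
  have hM' : ∀ᵐ x ∂μ, ∀ D, ∑ l ∈ Finset.range D, ev l ^ α * ef l x ^ 2 ≤ M ^ 2 := by
    filter_upwards [hgoodα, hM] with x h1 h2 D
    exact (h1.sum_le_tsum _ fun i _ => hnnα i x).trans h2
  have hM2 : ∀ᵐ x ∂μ, ∑ l ∈ Finset.range m₀, ef l x ^ 2 ≤ M ^ 2 * (8 * lam) ^ (-α) := by
    filter_upwards [hM'] with x hx
    have h8 : (0 : ℝ) < (8 * lam) ^ (-α) := Real.rpow_pos_of_pos (by positivity) _
    calc ∑ l ∈ Finset.range m₀, ef l x ^ 2 ≤ ∑ l ∈ Finset.range m₀, (ev l ^ α * ef l x ^ 2) * (8 * lam) ^ (-α) := by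
          refine Finset.sum_le_sum fun l hl' => ?_
          have h1 := hm₀2 l (Finset.mem_range.mp hl')
          have h2 : 1 ≤ ev l ^ α * (8 * lam) ^ (-α) := by
            rw [Real.rpow_neg (by positivity), ← div_eq_mul_inv, one_le_div (Real.rpow_pos_of_pos (by positivity) _)]
            exact Real.rpow_le_rpow (by positivity) h1 hα0.le
          nlinarith [sq_nonneg (ef l x)]
      _ = (∑ l ∈ Finset.range m₀, (ev l ^ α * ef l x ^ 2)) * (8 * lam) ^ (-α) := by rw [Finset.sum_mul]
      _ ≤ _ := by gcongr; exact hx m₀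
  have htail : ∀ᵐ x ∂μ, ∑' m, ev (m + D) * ef (m + D) x ^ 2 ≤ lam := by
    filter_upwards [hgoodα, hM] with x h1 h2
    have h3 := (summable_nat_add_iff D).mpr h1
    have e1 := h1.sum_add_tsum_nat_add D
    have h4 : ∑' m, ev (m + D) ^ α * ef (m + D) x ^ 2 ≤ M ^ 2 := by
      have : 0 ≤ ∑ l ∈ Finset.range D, ev l ^ α * ef l x ^ 2 := Finset.sum_nonneg fun l _ => hnnα l x
      linarith
    have h5 : ∀ m, ev (m + D) * ef (m + D) x ^ 2 ≤ ev D ^ (1 - α) * (ev (m + D) ^ α * ef (m + D) x ^ 2) := by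
      intro m
      have h6 : ev (m + D) = ev (m + D) ^ (1 - α) * ev (m + D) ^ α := by
        rw [← Real.rpow_add (hev_pos _)]; simp
      have h7 : ev (m + D) ^ (1 - α) ≤ ev D ^ (1 - α) :=
        Real.rpow_le_rpow (hev_pos _).le (hev_mono _ _ (by omega)) (by linarith)
      calc ev (m + D) * ef (m + D) x ^ 2 = ev (m + D) ^ (1 - α) * (ev (m + D) ^ α * ef (m + D) x ^ 2) := by
            conv_lhs => rw [h6]
            ring
        _ ≤ _ := mul_le_mul_of_nonneg_right h7 (hnnα _ _)
    have hs2 := h3.mul_left (ev D ^ (1 - α))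
    have hs1 := Summable.of_nonneg_of_le (fun m => mul_nonneg (hev_pos (m + D)).le (sq_nonneg _)) h5 hs2
    have h8 := hs1.tsum_le_tsum h5 hs2
    rw [tsum_mul_left] at h8
    have h9 : 0 < ev D ^ (1 - α) := Real.rpow_pos_of_pos (hev_pos D) _
    nlinarith
  have hP1 := aux_prob1 P μ X hX_meas hX_indep hX_id ev ef hev_pos horth hm lam α M hl hα0 hα1 hM' n hn D
  have hP2 := aux_prob2 P μ X hX_meas hX_indep hX_id ef horth _ m₀ hm₀ hM2 n hn
  have hall : ∀ᵐ ω ∂P, ∀ j, (Summable fun i => ev i * ef i (X j ω) ^ 2) ∧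
      ∑' m, ev (m + D) * ef (m + D) (X j ω) ^ 2 ≤ lam := by
    rw [ae_all_iff]
    intro j
    exact ae_of_ae_map (hX_meas j).aemeasurable (by rw [hX_id j]; exact hgood.and htail)
  refine le_trans ?_ (add_le_add hP1 hP2)
  refine le_trans (measure_mono_ae ?_) (measure_union_le _ _)
  filter_upwards [hall] with ω hω hbad
  by_contra hcon
  apply hbad
  have hcon' := not_or.mp hcon
  have H := not_not.mp hcon'.1
  have H2 := not_not.mp hcon'.2
  set x : Fin n → 𝓧 := fun i => X i ω with hx
  set A : Matrix (Fin n) (Fin n) ℝ := (Matrix.of fun i j => k (x i) (x j) / n) + lam • (1 : Matrix (Fin n) (Fin n) ℝ) with hA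
  have hV := aux_V μ k hk_symm ev ef σ2 n x lam (fun i j =>
    aux_kk μ k hk_symm B hB ev ef hev_pos hev_sum horth hmercer heig hgood hm (x i) (x j) (hω i).1 (hω j).1) A hA
  have hdet := aux_det hn ev hev_pos (fun m j => ef m (x j)) lam hl D
    (fun m => (hev_mono _ _ (by omega)).trans hevD) (fun j => (hω j).1) (fun j => (hω j).2) H A
    (by rw [hA]; simp only [hmercer])
  have hlow := aux_det_lower (n := n) ev
    (fun m => (A⁻¹ *ᵥ fun j => ef m (x j)) ⬝ᵥ (A⁻¹ *ᵥ fun j => ef m (x j)))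
    (fun m => (fun j => ef m (x j)) ⬝ᵥ (fun j => ef m (x j)))
    (fun m => aux_dot_self_nonneg _) (fun m => aux_dot_self_nonneg _) hn hdet.1 m₀
    (fun m hmm => hdet.2.2 m (by
      by_contra hmD
      have h1 := hm₀2 m hmm
      have h2 := hev_mono D m (by omega)
      linarith) (hm₀2 m hmm))
    (by simpa [dotProduct, sq] using H2)
  rw [hV]
  have hσn : 0 ≤ σ2 / n := by positivity
  exact ⟨mul_le_mul_of_nonneg_left hlow hσn, mul_le_mul_of_nonneg_left hdet.2.1 hσn⟩
end Fixed


section Asym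

lemma aux_step (r : ℝ) (hr : 0 < r) (t : ℕ) (ht : 0 < t) :
    ((t : ℝ) + 1) ^ (-(r + 1)) ≤ ((t : ℝ) ^ (-r) - ((t : ℝ) + 1) ^ (-r)) / r := by
  have ht0 : (0 : ℝ) < t := by exact_mod_cast ht
  have ht1 : (0 : ℝ) < (t : ℝ) + 1 := by linarith
  set x : ℝ := t / (t + 1) with hx
  have hx0 : 0 < x := by positivity
  have h1 : 1 + r / (t + 1) ≤ x ^ (-r) := by
    rw [Real.rpow_def_of_pos hx0]
    have h2 := Real.add_one_le_exp (Real.log x * -r)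
    have h3 := Real.log_le_sub_one_of_pos hx0
    have h4 : x - 1 = -(1 / ((t : ℝ) + 1)) := by rw [hx]; field_simp; ring
    have h5 : r / ((t : ℝ) + 1) = r * (1 / ((t : ℝ) + 1)) := by ring
    rw [h5]
    nlinarith
  have h2 : (t : ℝ) ^ (-r) = ((t : ℝ) + 1) ^ (-r) * x ^ (-r) := by
    rw [← Real.mul_rpow ht1.le hx0.le, hx, mul_div_cancel₀ _ ht1.ne']
  have h3 : ((t : ℝ) + 1) ^ (-(r + 1)) = ((t : ℝ) + 1) ^ (-r) / (t + 1) := by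
    rw [show -(r + 1) = -r - 1 by ring, Real.rpow_sub_one ht1.ne']
  have h4 : 0 < ((t : ℝ) + 1) ^ (-r) := Real.rpow_pos_of_pos ht1 _
  rw [le_div_iff₀ hr, h2, h3]
  have := mul_le_mul_of_nonneg_left h1 h4.le
  have e : ((t : ℝ) + 1) ^ (-r) / (t + 1) * r = ((t : ℝ) + 1) ^ (-r) * (1 + r / (t + 1)) - ((t : ℝ) + 1) ^ (-r) := by
    ring
  rw [e]; linarith

lemma aux_tailsum (r : ℝ) (hr : 0 < r) (t : ℕ) (ht : 0 < t) (N : ℕ) :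
    ∑ i ∈ Finset.range N, (((t + i : ℕ) : ℝ) + 1) ^ (-(r + 1)) ≤ (t : ℝ) ^ (-r) / r := by
  have : ∑ i ∈ Finset.range N, (((t + i : ℕ) : ℝ) + 1) ^ (-(r + 1)) ≤
      ((t : ℝ) ^ (-r) - ((t + N : ℕ) : ℝ) ^ (-r)) / r := by
    induction N with
    | zero => simp
    | succ N ih =>
      rw [Finset.sum_range_succ]
      have h := aux_step r hr (t + N) (by omega)
      have e : (((t + (N + 1) : ℕ) : ℝ)) = ((t + N : ℕ) : ℝ) + 1 := by push_cast; ring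
      rw [e]
      calc _ ≤ _ := add_le_add ih h
        _ = _ := by ring
  refine this.trans (div_le_div_of_nonneg_right ?_ hr.le)
  have : 0 ≤ ((t + N : ℕ) : ℝ) ^ (-r) := Real.rpow_nonneg (by positivity) _
  linarith

lemma aux_effdim (ev : ℕ → ℝ) (hev_pos : ∀ i, 0 < ev i) (β c₂ : ℝ) (hβ : 1 < β) (hc₂ : 0 < c₂)
    (hup : ∀ i : ℕ, ev i ≤ c₂ * ((i : ℝ) + 1) ^ (-β)) (lam : ℝ) (hl : 0 < lam) (hl1 : lam ≤ 1) (D : ℕ) :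
    ∑ m ∈ Finset.range D, ev m / (ev m + lam) ≤ (2 + c₂ / (β - 1)) * lam ^ (-1 / β) := by
  have hβ0 : 0 < β := by linarith
  set T : ℝ := lam ^ (-1 / β) with hT
  have hT1 : 1 ≤ T := Real.one_le_rpow_of_pos_of_le_one_of_nonpos hl hl1 (by
    rw [neg_div]; have : 0 < 1 / β := by positivity
    linarith)
  have hT0 : 0 < T := by linarith
  have hTl : T ^ (-β) = lam := by
    rw [hT, ← Real.rpow_mul hl.le, show -1 / β * -β = 1 by field_simp, Real.rpow_one]
  set t := ⌈T⌉₊ with ht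
  have ht0 : 0 < t := Nat.ceil_pos.mpr hT0
  have htT : T ≤ t := Nat.le_ceil T
  have htT2 : (t : ℝ) ≤ 2 * T := by
    have := Nat.ceil_lt_add_one hT0.le
    linarith
  have hnn : ∀ m, 0 ≤ ev m / (ev m + lam) := fun m => by have := hev_pos m; positivity
  have h1 : ∑ m ∈ Finset.range D, ev m / (ev m + lam) ≤ ∑ m ∈ Finset.range (t + D), ev m / (ev m + lam) :=
    Finset.sum_le_sum_of_subset_of_nonneg (Finset.range_subset_range.mpr (by omega)) fun m _ _ => hnn m
  refine h1.trans ?_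
  rw [Finset.sum_range_add, add_mul]
  refine add_le_add ?_ ?_
  · refine le_trans (Finset.sum_le_sum (g := fun _ => (1 : ℝ)) fun m _ => ?_) (by simpa using htT2)
    have := hev_pos m
    rw [div_le_one (by positivity)]; linarith
  · have h2 : ∀ i ∈ Finset.range D, ev (t + i) / (ev (t + i) + lam) ≤
        c₂ / lam * (((t + i : ℕ) : ℝ) + 1) ^ (-((β - 1) + 1)) := by
      intro i _
      have hp := hev_pos (t + i)
      have h3 := hup (t + i)
      rw [show -((β - 1) + 1) = -β by ring]
      calc _ ≤ ev (t + i) / lam := by gcongr; linarith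
        _ ≤ (c₂ * (((t + i : ℕ) : ℝ) + 1) ^ (-β)) / lam := by gcongr
        _ = _ := by ring
    refine (Finset.sum_le_sum h2).trans ?_
    rw [← Finset.mul_sum]
    have hr : 0 < β - 1 := by linarith
    have h4 := aux_tailsum (β - 1) hr t ht0 D
    have h5 : (t : ℝ) ^ (-(β - 1)) ≤ T ^ (-(β - 1)) :=
      Real.rpow_le_rpow_of_nonpos hT0 htT (by linarith)
    have h6 : T ^ (-(β - 1)) = T * lam := by
      rw [← hTl, show -(β - 1) = 1 + -β by ring, Real.rpow_add hT0, Real.rpow_one]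
    calc _ ≤ c₂ / lam * ((t : ℝ) ^ (-(β - 1)) / (β - 1)) := by gcongr
      _ ≤ c₂ / lam * ((T * lam) / (β - 1)) := by rw [← h6]; gcongr
      _ = _ := by field_simp

lemma aux_m0 (ev : ℕ → ℝ) (β c₁ : ℝ) (hβ : 1 < β) (hc₁ : 0 < c₁)
    (hlow : ∀ i : ℕ, c₁ * ((i : ℝ) + 1) ^ (-β) ≤ ev i) (lam : ℝ) (hl : 0 < lam)
    (hbig : 2 ≤ (c₁ / 8) ^ (1 / β) * lam ^ (-1 / β)) :
    ∃ m₀ : ℕ, 0 < m₀ ∧ (∀ m < m₀, 8 * lam ≤ ev m) ∧ (c₁ / 8) ^ (1 / β) * lam ^ (-1 / β) / 2 ≤ m₀ := by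
  have hβ0 : 0 < β := by linarith
  set Y := (c₁ / 8) ^ (1 / β) * lam ^ (-1 / β) with hY
  have hY0 : 0 < Y := by linarith
  refine ⟨⌊Y⌋₊, Nat.floor_pos.mpr (by linarith), ?_, ?_⟩
  · intro m hm
    have h1 : ((m : ℝ) + 1) ≤ Y := by
      have : ((m + 1 : ℕ) : ℝ) ≤ ⌊Y⌋₊ := by exact_mod_cast hm
      push_cast at this
      exact this.trans (Nat.floor_le hY0.le)
    have h2 : Y ^ (-β) ≤ ((m : ℝ) + 1) ^ (-β) :=
      Real.rpow_le_rpow_of_nonpos (by positivity) h1 (by linarith)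
    have h3 : Y ^ (-β) = 8 * lam / c₁ := by
      rw [hY, Real.mul_rpow (by positivity) (by positivity), ← Real.rpow_mul (by positivity), ← Real.rpow_mul hl.le,
        show 1 / β * -β = -1 by field_simp, show -1 / β * -β = 1 by field_simp, Real.rpow_one, Real.rpow_neg_one]
      field_simp
    calc 8 * lam = c₁ * (8 * lam / c₁) := by field_simp
      _ ≤ c₁ * ((m : ℝ) + 1) ^ (-β) := by rw [← h3]; gcongr
      _ ≤ _ := hlow m
  · have := Nat.lt_floor_add_one Y
    linarith

lemma aux_ev_summable (ev : ℕ → ℝ) (hev_pos : ∀ i, 0 < ev i) (β c₂ α : ℝ) (hc₂ : 0 < c₂)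
    (hup : ∀ i : ℕ, ev i ≤ c₂ * ((i : ℝ) + 1) ^ (-β)) (hα0 : 0 < α) (hαβ : 1 < β * α) :
    Summable fun i => ev i ^ α := by
  have h1 : Summable fun i : ℕ => ((i : ℝ)) ^ (-(β * α)) := Real.summable_nat_rpow.mpr (by linarith)
  have h2 := ((summable_nat_add_iff 1).mpr h1).mul_left (c₂ ^ α)
  refine Summable.of_nonneg_of_le (fun i => Real.rpow_nonneg (hev_pos i).le _) (fun i => ?_) h2
  refine (Real.rpow_le_rpow (hev_pos i).le (hup i) hα0.le).trans_eq ?_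
  rw [Real.mul_rpow hc₂.le (by positivity), ← Real.rpow_mul (by positivity)]
  push_cast
  congr 2
  ring

/-- asymptotic facts about the regularization sequence -/
lemma aux_asym (ev : ℕ → ℝ) (hev_pos : ∀ i, 0 < ev i) (β c₂ : ℝ) (hβ : 1 < β) (hc₂ : 0 < c₂)
    (hup : ∀ i : ℕ, ev i ≤ c₂ * ((i : ℝ) + 1) ^ (-β))
    (lam : ℕ → ℝ) (hlam_pos : ∀ n, 0 < lam n) (p : ℝ) (hp : 0 < p) (hpβ : p ≤ β - 1)
    (clam : ℝ) (hclam : 0 < clam) (hlow : ∀ᶠ n : ℕ in atTop, clam * (n : ℝ) ^ (-β + p) ≤ lam n)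
    (α M : ℝ) (hα : α = 1 / (β - p / 2)) (hα1 : α < 1) (ε : ℝ) (hε : 0 < ε) :
    ∃ q : ℕ, ∀ᶠ n : ℕ in atTop, ev (n ^ q) ≤ lam n ∧ M ^ 2 * ev (n ^ q) ^ (1 - α) ≤ lam n ∧
      ((n ^ q : ℕ) : ℝ) * Real.exp (-(n / (4 * (M ^ 2 * lam n ^ (-α) + 1)))) ≤ ε ∧
      M ^ 2 * (8 * lam n) ^ (-α) / n ≤ ε := by
  have hb : 0 < β - p / 2 := by linarith
  have hα0 : 0 < α := by rw [hα]; positivity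
  have hβ0 : 0 < β := by linarith
  set γ := 1 - (β - p) * α with hγ
  have hγ0 : 0 < γ := by
    have : γ = (p / 2) / (β - p / 2) := by
      rw [hγ, hα, eq_div_iff hb.ne', sub_mul, mul_assoc, one_div_mul_cancel hb.ne']; ring
    rw [this]; positivity
  have h1α : 0 < 1 - α := by linarith
  obtain ⟨q, hq⟩ := exists_nat_ge ((β + 1) / (β * (1 - α)))
  have hq1 : β + 1 ≤ q * (β * (1 - α)) := by rwa [div_le_iff₀ (by positivity)] at hq
  have hq2 : β + 1 ≤ q * β := by
    have : (q : ℝ) * (β * (1 - α)) ≤ q * β := by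
      refine mul_le_mul_of_nonneg_left ?_ (by positivity)
      nlinarith
    linarith
  refine ⟨q, ?_⟩
  set C' := M ^ 2 * clam ^ (-α) + 1 with hC'
  have hC0 : 0 < C' := by
    have : 0 < clam ^ (-α) := Real.rpow_pos_of_pos hclam _
    positivity
  have t1 : Tendsto (fun n : ℕ => ((n : ℝ) ^ γ) ^ (q / γ) * Real.exp (-(1 / (4 * C')) * (n : ℝ) ^ γ)) atTop (nhds 0) :=
    (tendsto_rpow_mul_exp_neg_mul_atTop_nhds_zero (q / γ) (1 / (4 * C')) (by positivity)).comp
      ((tendsto_rpow_atTop hγ0).comp tendsto_natCast_atTop_atTop)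
  have t2 : Tendsto (fun n : ℕ => C' * (n : ℝ) ^ (-γ)) atTop (nhds 0) := by
    have := ((tendsto_rpow_neg_atTop hγ0).comp (tendsto_natCast_atTop_atTop (R := ℝ))).const_mul C'
    simpa using this
  have g1 : ∀ᶠ n : ℕ in atTop, c₂ / clam ≤ n := tendsto_natCast_atTop_atTop.eventually_ge_atTop _
  have g2 : ∀ᶠ n : ℕ in atTop, M ^ 2 * c₂ ^ (1 - α) / clam ≤ n := tendsto_natCast_atTop_atTop.eventually_ge_atTop _
  filter_upwards [hlow, g1, g2, t1.eventually_le_const hε, t2.eventually_le_const hε, eventually_ge_atTop 1]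
    with n hn e1 e2 e3 e4 hn1
  have hn1' : (1 : ℝ) ≤ n := by exact_mod_cast hn1
  have hn0 : (0 : ℝ) < n := by linarith
  have hlp := hlam_pos n
  have hlamlow : ∀ c : ℝ, c / clam ≤ n → c * (n : ℝ) ^ (-(β + 1)) ≤ lam n := by
    intro c hc
    refine le_trans ?_ hn
    have h1 : (n : ℝ) ^ (-β) ≤ (n : ℝ) ^ (-β + p) := Real.rpow_le_rpow_of_exponent_le hn1' (by linarith)
    have h2 : (n : ℝ) ^ (-(β + 1)) = (n : ℝ) ^ (-β) / n := by
      rw [show -(β + 1) = -β - 1 by ring, Real.rpow_sub_one hn0.ne']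
    rw [div_le_iff₀ hclam] at hc
    have h3 : 0 < (n : ℝ) ^ (-β) := Real.rpow_pos_of_pos hn0 _
    calc c * (n : ℝ) ^ (-(β + 1)) = (c / n) * (n : ℝ) ^ (-β) := by rw [h2]; ring
      _ ≤ clam * (n : ℝ) ^ (-β) := by
        refine mul_le_mul_of_nonneg_right ?_ h3.le
        rw [div_le_iff₀ hn0]; linarith
      _ ≤ _ := by gcongr
  have hevq : ev (n ^ q) ≤ c₂ * (n : ℝ) ^ (-(q * β)) := by
    refine (hup _).trans ?_
    refine mul_le_mul_of_nonneg_left ?_ hc₂.le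
    have : (n : ℝ) ^ (-(q * β)) = ((n : ℝ) ^ q) ^ (-β) := by
      rw [← Real.rpow_natCast, ← Real.rpow_mul hn0.le]; congr 1; ring
    rw [this]
    push_cast
    exact Real.rpow_le_rpow_of_nonpos (by positivity) (by linarith) (by linarith)
  have hlα : M ^ 2 * lam n ^ (-α) + 1 ≤ C' * (n : ℝ) ^ (1 - γ) := by
    have h1 : lam n ^ (-α) ≤ clam ^ (-α) * (n : ℝ) ^ (1 - γ) := by
      have h2 : lam n ^ (-α) ≤ (clam * (n : ℝ) ^ (-β + p)) ^ (-α) :=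
        Real.rpow_le_rpow_of_nonpos (by positivity) hn (by linarith)
      rw [Real.mul_rpow hclam.le (by positivity), ← Real.rpow_mul hn0.le] at h2
      rwa [show (-β + p) * -α = 1 - γ by rw [hγ]; ring] at h2
    have h3 : 1 ≤ (n : ℝ) ^ (1 - γ) := Real.one_le_rpow hn1' (by
      rw [hγ]; have : 0 < β - p := by linarith
      have := mul_pos this hα0
      linarith)
    have := mul_le_mul_of_nonneg_left h1 (sq_nonneg M)
    rw [hC']; linarith
  have hRpos : 0 < M ^ 2 * lam n ^ (-α) + 1 := by
    have : 0 < lam n ^ (-α) := Real.rpow_pos_of_pos hlp _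
    positivity
  have hγn : (n : ℝ) / n ^ (1 - γ) = (n : ℝ) ^ γ := by
    rw [Real.rpow_sub hn0, Real.rpow_one]; field_simp
  refine ⟨?_, ?_, ?_, ?_⟩
  · refine hevq.trans (le_trans ?_ (hlamlow c₂ e1))
    refine mul_le_mul_of_nonneg_left ?_ hc₂.le
    exact Real.rpow_le_rpow_of_exponent_le hn1' (by linarith)
  · refine le_trans ?_ (hlamlow _ e2)
    have h1 : ev (n ^ q) ^ (1 - α) ≤ c₂ ^ (1 - α) * (n : ℝ) ^ (-(β + 1)) := by
      refine (Real.rpow_le_rpow (hev_pos _).le hevq h1α.le).trans ?_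
      rw [Real.mul_rpow hc₂.le (by positivity), ← Real.rpow_mul hn0.le]
      refine mul_le_mul_of_nonneg_left ?_ (by positivity)
      exact Real.rpow_le_rpow_of_exponent_le hn1' (by linarith)
    calc _ ≤ M ^ 2 * (c₂ ^ (1 - α) * (n : ℝ) ^ (-(β + 1))) := by gcongr
      _ = _ := by ring
  · refine le_trans ?_ e3
    have h1 : ((n ^ q : ℕ) : ℝ) = ((n : ℝ) ^ γ) ^ (q / γ) := by
      rw [← Real.rpow_mul hn0.le, mul_div_cancel₀ _ hγ0.ne', Real.rpow_natCast]; push_cast; rfl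
    rw [h1]
    refine mul_le_mul_of_nonneg_left (Real.exp_le_exp.mpr ?_) (by positivity)
    rw [neg_mul, neg_le_neg_iff, ← hγn]
    calc 1 / (4 * C') * ((n : ℝ) / n ^ (1 - γ)) = n / (4 * (C' * (n : ℝ) ^ (1 - γ))) := by
          field_simp
      _ ≤ _ := by gcongr
  · refine le_trans ?_ e4
    have h1 : (8 * lam n) ^ (-α) ≤ lam n ^ (-α) :=
      Real.rpow_le_rpow_of_nonpos hlp (by linarith) (by linarith)
    have h2 : (n : ℝ) ^ (-γ) = n ^ (1 - γ) / n := by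
      rw [show -γ = 1 - γ - 1 by ring, Real.rpow_sub_one hn0.ne']
    rw [h2, ← mul_div_assoc]
    refine div_le_div_of_nonneg_right (le_trans ?_ hlα) hn0.le
    have := mul_le_mul_of_nonneg_left h1 (sq_nonneg M)
    linarith
end Asym


/-- Under the eigenvalue decay, embedding index, Hölder continuity and noise
assumptions, if `λ(n) → 0` and `λ(n) = Ω(n^{-β+p})` for some `p > 0`, then for any
`δ ∈ (0,1)`, for `n` sufficiently large, with probability at least `1-δ` over the sample:
`c σ² λ(n)^{-1/β}/n ≤ V(λ(n)) ≤ C σ² λ(n)^{-1/β}/n` with constants `c, C > 0` independent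
of `δ`, `n`, `λ`. -/
theorem kernel_interp_stmt10 {d : ℕ} (𝓧 : Set (EuclideanSpace ℝ (Fin d)))
    (hXcomp : IsCompact 𝓧) [MeasurableSpace ↥𝓧]
    (μ : Measure ↥𝓧) [IsProbabilityMeasure μ]
    (k : ↥𝓧 → ↥𝓧 → ℝ) (hk_symm : ∀ x y, k x y = k y x)
    (hk_cont : Continuous (Function.uncurry k))
    -- Mercer decomposition
    (ev : ℕ → ℝ) (ef : ℕ → ↥𝓧 → ℝ)
    (hev_pos : ∀ i, 0 < ev i) (hev_mono : ∀ i j, i ≤ j → ev j ≤ ev i)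
    (hef_cont : ∀ i, Continuous (ef i))
    (horth : ∀ i j, ∫ t, ef i t * ef j t ∂μ = if i = j then (1 : ℝ) else 0)
    (hmercer : ∀ x y, k x y = ∑' i, ev i * ef i x * ef i y)
    (heig : ∀ i x, ∫ y, k x y * ef i y ∂μ = ev i * ef i x)
    -- Assumption 1: eigenvalue decay
    (β c₁ c₂ : ℝ) (hβ : 1 < β) (hc₁ : 0 < c₁) (hc₂ : 0 < c₂)
    (hlow : ∀ i : ℕ, c₁ * ((i : ℝ) + 1) ^ (-β) ≤ ev i)
    (hup : ∀ i : ℕ, ev i ≤ c₂ * ((i : ℝ) + 1) ^ (-β))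
    -- Assumption 2: embedding index α₀ = 1/β
    (hemb : ∀ α : ℝ, 1 / β < α → ∃ M : ℝ, 0 < M ∧
      ∀ᵐ x ∂μ, ∑' i, ev i ^ α * ef i x ^ 2 ≤ M ^ 2)
    -- Assumption 3: Hölder continuity of the kernel
    (L s : ℝ) (hs0 : 0 < s) (hs1 : s ≤ 1) (hL : 0 < L)
    (hHolder : ∀ x₁ x₂ y₁ y₂ : ↥𝓧,
      |k x₁ x₂ - k y₁ y₂| ≤ L * Real.sqrt (dist x₁ y₁ ^ 2 + dist x₂ y₂ ^ 2) ^ s)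
    -- Assumption 4: noise level
    (σ2 : ℝ) (hσ2 : 0 < σ2)
    -- i.i.d. sample sequence from μ
    {Ω : Type*} [MeasurableSpace Ω] (P : Measure Ω) [IsProbabilityMeasure P]
    (X : ℕ → Ω → ↥𝓧) (hX_meas : ∀ i, Measurable (X i))
    (hX_indep : iIndepFun X P)
    (hX_id : ∀ i, P.map (X i) = μ)
    -- regularization sequence: λ(n) → 0 and λ(n) = Ω(n^{-β+p})
    (lam : ℕ → ℝ) (hlam_pos : ∀ n, 0 < lam n)
    (hlam_to0 : Tendsto lam atTop (nhds 0))
    (p : ℝ) (hp : 0 < p)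
    (hlam_low : ∃ clam : ℝ, 0 < clam ∧
      ∀ᶠ n : ℕ in atTop, clam * (n : ℝ) ^ (-β + p) ≤ lam n) :
    ∃ c C : ℝ, 0 < c ∧ 0 < C ∧ ∀ δ : ℝ, 0 < δ → δ < 1 → ∃ N : ℕ, ∀ n ≥ N,
      ENNReal.ofReal (1 - δ) ≤
        P {ω |
          c * σ2 * (lam n) ^ (-1 / β) / n
              ≤ varianceTerm10 μ k σ2 n (fun i : Fin n => X i ω) (lam n) ∧
          varianceTerm10 μ k σ2 n (fun i : Fin n => X i ω) (lam n)
              ≤ C * σ2 * (lam n) ^ (-1 / β) / n} := by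
  obtain ⟨clam, hclam, hlow'⟩ := hlam_low
  have hβ0 : 0 < β := by linarith
  -- shrink the exponent
  set p' := min p (β - 1) with hp'
  have hp'0 : 0 < p' := lt_min hp (by linarith)
  have hp'1 : p' ≤ β - 1 := min_le_right _ _
  have hp'p : p' ≤ p := min_le_left _ _
  have hlow2 : ∀ᶠ n : ℕ in atTop, clam * (n : ℝ) ^ (-β + p') ≤ lam n := by
    filter_upwards [hlow', eventually_ge_atTop 1] with n hn hn1
    refine le_trans (mul_le_mul_of_nonneg_left ?_ hclam.le) hn
    exact Real.rpow_le_rpow_of_exponent_le (by exact_mod_cast hn1) (by linarith)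
  obtain ⟨α, hα⟩ : ∃ α, α = 1 / (β - p' / 2) := ⟨_, rfl⟩
  have hb1 : 1 < β - p' / 2 := by linarith
  have hb0 : 0 < β - p' / 2 := by linarith
  have hα0 : 0 < α := by rw [hα]; positivity
  have hα1 : α < 1 := by rw [hα, div_lt_one hb0]; exact hb1
  have hαβ : 1 / β < α := by
    rw [hα]; exact one_div_lt_one_div_of_lt hb0 (by linarith)
  have hαβ2 : 1 < β * α := by
    rw [div_lt_iff₀ hβ0] at hαβ; linarith
  obtain ⟨M, hM0, hM⟩ := hemb α hαβ
  -- analytic facts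
  have hsα := aux_ev_summable ev hev_pos β c₂ α hc₂ hup hα0 hαβ2
  have hs1 : Summable ev := by
    have := aux_ev_summable ev hev_pos β c₂ 1 hc₂ hup one_pos (by linarith)
    simpa using this
  have hgood := aux_ae_summable μ ef horth ev (fun i => (hev_pos i).le) hs1
  have hgoodα := aux_ae_summable μ ef horth (fun i => ev i ^ α)
    (fun i => Real.rpow_nonneg (hev_pos i).le _) hsα
  have hm := aux_prod_aemeasurable μ k hk_cont ev ef hev_pos horth hmercer heig hgood
  obtain ⟨B, hB⟩ : ∃ B, ∀ x y, |k x y| ≤ B := by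
    haveI : CompactSpace ↥𝓧 := isCompact_iff_compactSpace.mp hXcomp
    obtain ⟨B, hB⟩ := isCompact_univ.exists_bound_of_continuousOn hk_cont.continuousOn
    exact ⟨B, fun x y => hB (x, y) (Set.mem_univ _)⟩
  -- constants
  set CN := 2 + c₂ / (β - 1) with hCN
  have hCN0 : 0 < CN := by
    have : 0 < β - 1 := by linarith
    positivity
  set κ := (c₁ / 8) ^ (1 / β) with hκ
  have hκ0 : 0 < κ := Real.rpow_pos_of_pos (by positivity) _
  refine ⟨κ / 64, 4 * (4 * CN + 1), by positivity, by positivity, ?_⟩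
  intro δ hδ0 hδ1
  obtain ⟨q, hq⟩ := aux_asym ev hev_pos β c₂ hβ hc₂ hup lam hlam_pos p' hp'0 hp'1 clam hclam hlow2
    α M hα hα1 (δ / 2) (by positivity)
  have hlamgt : Tendsto lam atTop (nhdsWithin 0 (Set.Ioi 0)) :=
    tendsto_nhdsWithin_iff.mpr ⟨hlam_to0, Eventually.of_forall hlam_pos⟩
  have hbig : ∀ᶠ n : ℕ in atTop, 2 ≤ κ * lam n ^ (-1 / β) := by
    have h1 : Tendsto (fun n => ((lam n)⁻¹) ^ (1 / β)) atTop atTop :=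
      (tendsto_rpow_atTop (by positivity)).comp (tendsto_inv_nhdsGT_zero.comp hlamgt)
    filter_upwards [h1.eventually_ge_atTop (2 / κ)] with n hn
    rw [div_le_iff₀ hκ0, Real.inv_rpow (hlam_pos n).le, ← Real.rpow_neg (hlam_pos n).le] at hn
    rw [neg_div]; linarith
  have hle1 : ∀ᶠ n : ℕ in atTop, lam n ≤ 1 := hlam_to0.eventually_le_const one_pos
  obtain ⟨N, hN⟩ := eventually_atTop.mp (hq.and (hbig.and (hle1.and (eventually_ge_atTop 1))))
  refine ⟨N, fun n hn => ?_⟩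
  obtain ⟨⟨q1, q2, q3, q4⟩, b1, b2, b3⟩ := hN n hn
  have hn0 : (0 : ℝ) < n := by exact_mod_cast b3
  obtain ⟨m₀, hm₀, hm₀2, hm₀3⟩ := aux_m0 ev β c₁ hβ hc₁ hlow (lam n) (hlam_pos n) b1
  have key := aux_fixed P μ X hX_meas hX_indep hX_id k hk_symm B hB ev ef hev_pos hs1 hev_mono horth
    hmercer heig hgood hm α M hα0 hα1.le hgoodα hM σ2 hσ2 n b3 (lam n) (hlam_pos n) (n ^ q) q1 q2 m₀ hm₀ hm₀2
  have heff := aux_effdim ev hev_pos β c₂ hβ hc₂ hup (lam n) (hlam_pos n) b2 (n ^ q)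
  rw [← hCN] at heff
  set T := lam n ^ (-1 / β) with hT
  have hT1 : 1 ≤ T := Real.one_le_rpow_of_pos_of_le_one_of_nonpos (hlam_pos n) b2 (by
    rw [neg_div]; have : 0 < 1 / β := by positivity
    linarith)
  have hσn : 0 ≤ σ2 / n := by positivity
  have hsub : {ω | ¬ (κ / 64 * σ2 * T / n ≤ varianceTerm10 μ k σ2 n (fun i : Fin n => X i ω) (lam n) ∧
      varianceTerm10 μ k σ2 n (fun i : Fin n => X i ω) (lam n) ≤ 4 * (4 * CN + 1) * σ2 * T / n)} ⊆
      {ω | ¬ (σ2 / n * (m₀ / 32) ≤ varianceTerm10 μ k σ2 n (fun i : Fin n => X i ω) (lam n) ∧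
        varianceTerm10 μ k σ2 n (fun i : Fin n => X i ω) (lam n) ≤
          σ2 / n * (4 * (∑ m ∈ Finset.range (n ^ q), 4 * ev m / (ev m + lam n) + 1)))} := by
    intro ω hω hcon
    apply hω
    refine ⟨le_trans ?_ hcon.1, hcon.2.trans ?_⟩
    · calc κ / 64 * σ2 * T / n = σ2 / n * ((κ * T / 2) / 32) := by ring
        _ ≤ _ := by gcongr
    · have e1 : ∑ m ∈ Finset.range (n ^ q), 4 * ev m / (ev m + lam n) =
          4 * ∑ m ∈ Finset.range (n ^ q), ev m / (ev m + lam n) := by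
        rw [Finset.mul_sum]
        exact Finset.sum_congr rfl fun m _ => by ring
      rw [e1]
      calc _ ≤ σ2 / n * (4 * (4 * (CN * T) + T)) := by gcongr
        _ = _ := by ring
  have hbad : P {ω | ¬ (κ / 64 * σ2 * T / n ≤ varianceTerm10 μ k σ2 n (fun i : Fin n => X i ω) (lam n) ∧
      varianceTerm10 μ k σ2 n (fun i : Fin n => X i ω) (lam n) ≤ 4 * (4 * CN + 1) * σ2 * T / n)} ≤
      ENNReal.ofReal δ := by
    refine (measure_mono hsub).trans (key.trans ?_)
    have h2 : M ^ 2 * (8 * lam n) ^ (-α) / (n * m₀) ≤ δ / 2 := by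
      refine le_trans ?_ q4
      have hm1 : (1 : ℝ) ≤ m₀ := by exact_mod_cast hm₀
      have : 0 ≤ (8 * lam n) ^ (-α) := Real.rpow_nonneg (by have := hlam_pos n; positivity) _
      refine div_le_div_of_nonneg_left (by positivity) hn0 ?_
      nlinarith
    calc _ ≤ ENNReal.ofReal (δ / 2) + ENNReal.ofReal (δ / 2) :=
          add_le_add (ENNReal.ofReal_le_ofReal q3) (ENNReal.ofReal_le_ofReal h2)
      _ = ENNReal.ofReal δ := by
          rw [← ENNReal.ofReal_add (by positivity) (by positivity), add_halves]
  set S := {ω | κ / 64 * σ2 * T / n ≤ varianceTerm10 μ k σ2 n (fun i : Fin n => X i ω) (lam n) ∧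
      varianceTerm10 μ k σ2 n (fun i : Fin n => X i ω) (lam n) ≤ 4 * (4 * CN + 1) * σ2 * T / n} with hS
  have h1 : (1 : ENNReal) ≤ P S + ENNReal.ofReal δ := by
    calc (1 : ENNReal) = P Set.univ := measure_univ.symm
      _ ≤ P (S ∪ Sᶜ) := measure_mono (by rw [Set.union_compl_self])
      _ ≤ P S + P Sᶜ := measure_union_le _ _
      _ ≤ _ := by gcongr; exact hbad
  rw [ENNReal.ofReal_sub 1 hδ0.le, ENNReal.ofReal_one]
  exact tsub_le_iff_right.mpr h1
end

section
/- Let μ be a probability measure on 𝒳, f ∈ L²(𝒳,μ) with ‖f‖_{L^∞} ≤ M, and x₁,…,xₙ i.i.d. samples from μ. Then with probability at least 1−δ: (1/2)‖f‖²_{L²} − (5M²/(3n)) ln(2/δ) ≤ ‖f‖²_{L²,n} ≤ (3/2)‖f‖²_{L²} + (5M²/(3n)) ln(2/δ), where ‖f‖²_{L²,n} = (1/n)Σ_{i=1}^n f(xᵢ)². -/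
open MeasureTheory ProbabilityTheory

lemma exp_chord (t z : ℝ) (h0 : 0 ≤ z) (h1 : z ≤ 1) :
    Real.exp (t * z) ≤ 1 + z * (Real.exp t - 1) := by
  have h := convexOn_exp.2 (Set.mem_univ (0 : ℝ)) (Set.mem_univ t)
    (sub_nonneg.2 h1) h0 (by ring)
  simp only [smul_eq_mul, mul_zero, zero_add, Real.exp_zero, mul_one] at h
  rw [mul_comm t z]
  linarith

lemma mgf_bound {𝓧 : Type*} [MeasurableSpace 𝓧]
    (μ : Measure 𝓧) [IsProbabilityMeasure μ] (Z : 𝓧 → ℝ) (hZ : Measurable Z)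
    (h01 : ∀ᵐ s ∂μ, Z s ∈ Set.Icc (0 : ℝ) 1) (t : ℝ) :
    mgf Z μ t ≤ Real.exp ((∫ s, Z s ∂μ) * (Real.exp t - 1)) := by
  have hi : Integrable Z μ := Integrable.of_mem_Icc 0 1 hZ.aemeasurable h01
  have h1 : mgf Z μ t ≤ ∫ s, (1 + Z s * (Real.exp t - 1)) ∂μ := by
    refine integral_mono_ae (integrable_exp_mul_of_mem_Icc hZ.aemeasurable h01)
      ((integrable_const _).add (hi.mul_const _)) ?_
    filter_upwards [h01] with s hs
    exact exp_chord t _ hs.1 hs.2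
  rw [integral_add (integrable_const _) (hi.mul_const _), integral_mul_const] at h1
  simp only [integral_const, probReal_univ, smul_eq_mul, mul_one] at h1
  have := Real.add_one_le_exp ((∫ s, Z s ∂μ) * (Real.exp t - 1))
  linarith

lemma exp_up : Real.exp (3/5) - 1 ≤ 9/10 := by
  have h := Real.exp_bound' (x := 3/5) (by norm_num) (by norm_num) (n := 5) (by norm_num)
  norm_num [Finset.sum_range_succ, Nat.factorial] at h
  linarith

lemma exp_dn : Real.exp (-(3/5)) - 1 ≤ -(3/10) := by
  have h := Real.quadratic_le_exp_of_nonneg (x := 3/5) (by norm_num)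
  rw [Real.exp_neg]
  have : (Real.exp (3/5))⁻¹ ≤ (7/10) := by
    rw [inv_le_comm₀ (Real.exp_pos _) (by norm_num)]
    norm_num at h ⊢
    linarith
  linarith

lemma mgf_sum_bound {𝓧 : Type*} [MeasurableSpace 𝓧]
    (μ : Measure 𝓧) [IsProbabilityMeasure μ]
    {Ω : Type*} [MeasurableSpace Ω] (P : Measure Ω) [IsProbabilityMeasure P]
    (n : ℕ) (x : Fin n → Ω → 𝓧) (hmeas : ∀ i, Measurable (x i))
    (hindep : iIndepFun x P) (hid : ∀ i, P.map (x i) = μ)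
    (Z : 𝓧 → ℝ) (hZ : Measurable Z)
    (h01 : ∀ᵐ s ∂μ, Z s ∈ Set.Icc (0 : ℝ) 1) (t : ℝ) :
    mgf (∑ i, fun ω => Z (x i ω)) P t ≤
      Real.exp (n * ((∫ s, Z s ∂μ) * (Real.exp t - 1))) := by
  have hind : iIndepFun (fun i ω => Z (x i ω)) P := hindep.comp (fun _ => Z) (fun _ => hZ)
  rw [hind.mgf_sum (fun i => hZ.comp (hmeas i)) Finset.univ]
  have hb : ∀ i ∈ (Finset.univ : Finset (Fin n)), mgf (fun ω => Z (x i ω)) P t ≤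
      Real.exp ((∫ s, Z s ∂μ) * (Real.exp t - 1)) := by
    intro i _
    refine le_trans (le_of_eq ?_) (mgf_bound μ Z hZ h01 t)
    rw [← hid i, mgf_map (hmeas i).aemeasurable (by fun_prop)]
    rfl
  refine (Finset.prod_le_prod (fun i _ => mgf_nonneg) hb).trans (le_of_eq ?_)
  rw [Finset.prod_const, Finset.card_univ, Fintype.card_fin, ← Real.exp_nat_mul]

lemma tail_bounds {𝓧 : Type*} [MeasurableSpace 𝓧]
    (μ : Measure 𝓧) [IsProbabilityMeasure μ]
    {Ω : Type*} [MeasurableSpace Ω] (P : Measure Ω) [IsProbabilityMeasure P]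
    (n : ℕ) (x : Fin n → Ω → 𝓧) (hmeas : ∀ i, Measurable (x i))
    (hindep : iIndepFun x P) (hid : ∀ i, P.map (x i) = μ)
    (Z : 𝓧 → ℝ) (hZ : Measurable Z)
    (h01 : ∀ᵐ s ∂μ, Z s ∈ Set.Icc (0 : ℝ) 1) (L : ℝ) :
    P.real {ω | n * (3/2 * ∫ s, Z s ∂μ) + 5/3 * L ≤ (∑ i, fun ω => Z (x i ω)) ω} ≤ Real.exp (-L) ∧
    P.real {ω | (∑ i, fun ω => Z (x i ω)) ω ≤ n * (1/2 * ∫ s, Z s ∂μ) - 5/3 * L}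
      ≤ Real.exp (-L) := by
  have hp : 0 ≤ ∫ s, Z s ∂μ := integral_nonneg_of_ae (h01.mono fun s hs => hs.1)
  have hind : iIndepFun (fun i ω => Z (x i ω)) P := hindep.comp (fun _ => Z) (fun _ => hZ)
  have hint : ∀ t, Integrable (fun ω => Real.exp (t * (∑ i, fun ω => Z (x i ω)) ω)) P := by
    intro t
    refine hind.integrable_exp_mul_sum (fun i => hZ.comp (hmeas i)) (s := Finset.univ) ?_
    intro i _
    refine integrable_exp_mul_of_mem_Icc (a := 0) (b := 1) (hZ.comp (hmeas i)).aemeasurable ?_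
    have := h01
    rw [← hid i] at this
    exact ae_of_ae_map (hmeas i).aemeasurable this
  have hnp : 0 ≤ n * ∫ s, Z s ∂μ := by positivity
  constructor
  · refine (measure_ge_le_exp_mul_mgf _ (t := 3/5) (by norm_num) (hint _)).trans ?_
    refine (mul_le_mul_of_nonneg_left (mgf_sum_bound μ P n x hmeas hindep hid Z hZ h01 _)
      (Real.exp_pos _).le).trans ?_
    rw [← Real.exp_add, Real.exp_le_exp]
    nlinarith [mul_le_mul_of_nonneg_left exp_up hnp]
  · refine (measure_le_le_exp_mul_mgf _ (t := -(3/5)) (by norm_num) (hint _)).trans ?_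
    refine (mul_le_mul_of_nonneg_left (mgf_sum_bound μ P n x hmeas hindep hid Z hZ h01 _)
      (Real.exp_pos _).le).trans ?_
    rw [← Real.exp_add, Real.exp_le_exp]
    nlinarith [mul_le_mul_of_nonneg_left exp_dn hnp]

/-- Let `μ` be a probability measure, `f ∈ L²(μ)` with `‖f‖_∞ ≤ M`, and
`x₁,…,xₙ` i.i.d. from `μ`. With probability at least `1-δ`,
`(1/2)‖f‖²_{L²} - (5M²/(3n))ln(2/δ) ≤ ‖f‖²_{L²,n} ≤ (3/2)‖f‖²_{L²} + (5M²/(3n))ln(2/δ)`,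
where `‖f‖²_{L²,n} = (1/n) Σᵢ f(xᵢ)²`. -/
theorem kernel_interp_stmt15 {𝓧 : Type*} [MeasurableSpace 𝓧]
    (μ : Measure 𝓧) [IsProbabilityMeasure μ]
    {Ω : Type*} [MeasurableSpace Ω] (P : Measure Ω) [IsProbabilityMeasure P]
    (n : ℕ) (hn : 0 < n)
    (x : Fin n → Ω → 𝓧) (hmeas : ∀ i, Measurable (x i))
    (hindep : iIndepFun x P)
    (hid : ∀ i, P.map (x i) = μ)
    (f : 𝓧 → ℝ) (hf : Measurable f) (hfL2 : MemLp f 2 μ)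
    (M : ℝ) (hM : ∀ᵐ t ∂μ, |f t| ≤ M)
    (δ : ℝ) (hδ0 : 0 < δ) (hδ1 : δ < 1) :
    ENNReal.ofReal (1 - δ) ≤
      P {ω |
        (1 / 2) * (∫ t, f t ^ 2 ∂μ) - 5 * M ^ 2 / (3 * n) * Real.log (2 / δ)
            ≤ (n : ℝ)⁻¹ * ∑ i, f (x i ω) ^ 2 ∧
        (n : ℝ)⁻¹ * ∑ i, f (x i ω) ^ 2
            ≤ (3 / 2) * (∫ t, f t ^ 2 ∂μ) + 5 * M ^ 2 / (3 * n) * Real.log (2 / δ)} := by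
  have hM' : ∀ᵐ t ∂μ, 0 ≤ M ∧ f t ^ 2 ≤ M ^ 2 := by
    filter_upwards [hM] with t ht
    exact ⟨(abs_nonneg _).trans ht, sq_le_sq' (abs_le.1 ht).1 (abs_le.1 ht).2⟩
  have hM0 : 0 ≤ M := by
    obtain ⟨t, ht⟩ := hM'.exists
    exact ht.1
  have hnR : (0 : ℝ) < n := by exact_mod_cast hn
  rcases hM0.eq_or_lt with h0 | hMpos
  · have hf0 : ∀ᵐ t ∂μ, f t ^ 2 = 0 := by
      filter_upwards [hM'] with t ht
      have := ht.2
      rw [← h0] at this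
      nlinarith [sq_nonneg (f t)]
    have hI : ∫ t, f t ^ 2 ∂μ = 0 := by
      rw [integral_congr_ae hf0]; simp
    have hall : ∀ᵐ ω ∂P, ∀ i, f (x i ω) ^ 2 = 0 := by
      rw [ae_all_iff]
      intro i
      have := hf0
      rw [← hid i] at this
      exact ae_of_ae_map (hmeas i).aemeasurable this
    have h1 : P {ω |
        (1 / 2) * (∫ t, f t ^ 2 ∂μ) - 5 * M ^ 2 / (3 * n) * Real.log (2 / δ)
            ≤ (n : ℝ)⁻¹ * ∑ i, f (x i ω) ^ 2 ∧
        (n : ℝ)⁻¹ * ∑ i, f (x i ω) ^ 2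
            ≤ (3 / 2) * (∫ t, f t ^ 2 ∂μ) + 5 * M ^ 2 / (3 * n) * Real.log (2 / δ)} = 1 := by
      rw [← prob_compl_eq_zero_iff₀]
      · change ∀ᵐ ω ∂P, _
        filter_upwards [hall] with ω hω
        simp [hω, hI, ← h0]
      · apply MeasurableSet.nullMeasurableSet
        measurability
    rw [h1]
    exact ENNReal.ofReal_le_one.2 (by linarith)
  · have hM2 : 0 < M ^ 2 := by positivity
    have hZ : Measurable (fun s => f s ^ 2 / M ^ 2) := by fun_prop
    have h01 : ∀ᵐ s ∂μ, f s ^ 2 / M ^ 2 ∈ Set.Icc (0 : ℝ) 1 := by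
      filter_upwards [hM'] with s hs
      exact ⟨by positivity, (div_le_one hM2).2 hs.2⟩
    obtain ⟨hu, hl⟩ := tail_bounds μ P n x hmeas hindep hid _ hZ h01 (Real.log (2 / δ))
    have hexp : Real.exp (-Real.log (2 / δ)) = δ / 2 := by
      rw [Real.exp_neg, Real.exp_log (by positivity), inv_div]
    rw [hexp] at hu hl
    set A := {ω | n * (3/2 * ∫ s, f s ^ 2 / M ^ 2 ∂μ) + 5/3 * Real.log (2 / δ) ≤
      (∑ i, fun ω => f (x i ω) ^ 2 / M ^ 2) ω} with hA
    set B := {ω | (∑ i, fun ω => f (x i ω) ^ 2 / M ^ 2) ω ≤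
      n * (1/2 * ∫ s, f s ^ 2 / M ^ 2 ∂μ) - 5/3 * Real.log (2 / δ)} with hB
    have hmS : Measurable (fun ω => (∑ i, fun ω => f (x i ω) ^ 2 / M ^ 2) ω) := by
      simp only [Finset.sum_apply]
      fun_prop
    have hAm : MeasurableSet A := measurableSet_le measurable_const hmS
    have hBm : MeasurableSet B := measurableSet_le hmS measurable_const
    have hAB : P.real (A ∪ B) ≤ δ := (measureReal_union_le A B).trans (by linarith)
    have hc : 1 - δ ≤ P.real (A ∪ B)ᶜ := by
      rw [probReal_compl_eq_one_sub (hAm.union hBm)]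
      linarith
    refine (ENNReal.ofReal_le_ofReal hc).trans ?_
    rw [ofReal_measureReal]
    refine measure_mono ?_
    intro ω hω
    simp only [Set.mem_compl_iff, Set.mem_union, not_or, hA, hB, Set.mem_ofPred_eq, not_le,
      Finset.sum_apply, integral_div, ← Finset.sum_div] at hω
    obtain ⟨h1, h2⟩ := hω
    simp only [Set.mem_ofPred_eq]
    generalize (∑ i, f (x i ω) ^ 2) = S at *
    generalize (∫ s, f s ^ 2 ∂μ) = I at *
    generalize Real.log (2 / δ) = L at *
    have e : (n : ℝ)⁻¹ * S = M ^ 2 / n * (S / M ^ 2) := by field_simp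
    have hk : 0 < M ^ 2 / n := by positivity
    constructor
    · refine le_of_eq_of_le ?_ (le_of_le_of_eq (mul_le_mul_of_nonneg_left h2.le hk.le) e.symm)
      field_simp
    · refine le_of_eq_of_le e ((mul_le_mul_of_nonneg_left h1.le hk.le).trans_eq ?_)
      field_simp
end
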